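/- Let U ⊆ ℂ^m be a connected open set and let Φ : U × conj(U) → ℂ be a nowhere-zero holomorphic Nash function such that Φ(z, conj(z)) is real and positive for every z ∈ U and such that for every z ∈ U the Hermitian matrix ( g^Φ_{ij}(z, conj(z)) )_{1 ≤ i, j ≤ m} is positive definite (so that z ↦ log Φ(z, conj(z)) is a Kähler potential with Nash-algebraic exponential polarization). Let D^Φ = det( g^Φ_{ij} ) on U × conj(U). Let l ∈ ℝ, let k and n be positive integers, let α, β, μ ∈ ℝ, and let u : [0, 1) → ℝ be a smooth function such that exp∘u is rational, i.e. there exist real polynomials p and q with q(x) ≠ 0 and exp(u(x)) = p(x)/q(x) for all x ∈ [0, 1). Set 𝔹 = {(z, ξ) ∈ U × ℂ^k : ‖ξ‖² · (Re Φ(z, conj(z)))^l < 1} (the unit ball bundle, in a local trivialization, of the k-fold direct sum of the Hermitian line bundle with fiber metric h(z) = (Re Φ(z, conj(z)))^l, whose curvature form is l times the Kähler form of the base). Let V ⊆ ℂ be a connected open set and let F = (f₁, …, f_n) : V → ℂ^n and G = (G₁, G₂) : V → 𝔹 ⊆ U × ℂ^k be holomorphic maps satisfying, for every s ∈ V, Δ_s(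 Σ_{j=1}^n |f_j(s)|² ) = μ · Δ_s( −α · log( Re D^Φ(G₁(s), conj(G₁(s))) ) + β · log( Re Φ(G₁(s), conj(G₁(s))) ) + u( ‖G₂(s)‖² · (Re Φ(G₁(s), conj(G₁(s))))^l ) ). Then F is constant on V. -/

import Mathlib

open scoped ComplexOrder

/-- `f` is a Nash function at the point `p₀` of `W ⊆ ℂ^m × ℂ^m`. -/
def IsNashAtPair (m : ℕ) (W : Set ((Fin m → ℂ) × (Fin m → ℂ)))
    (f : (Fin m → ℂ) × (Fin m → ℂ) → ℂ) (p₀ : (Fin m → ℂ) × (Fin m → ℂ)) : Prop :=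
  ∃ U : Set ((Fin m → ℂ) × (Fin m → ℂ)), IsOpen U ∧ p₀ ∈ U ∧ U ⊆ W ∧
    ∃ P : MvPolynomial (Option (Fin m ⊕ Fin m)) ℂ, P ≠ 0 ∧
      ∀ p ∈ U, MvPolynomial.eval (fun o => o.elim (f p) (Sum.elim p.1 p.2)) P = 0

/-- `f` is a Nash function on `W`: holomorphic on `W` and Nash at every point of `W`. -/
def IsNashOnPair (m : ℕ) (W : Set ((Fin m → ℂ) × (Fin m → ℂ)))
    (f : (Fin m → ℂ) × (Fin m → ℂ) → ℂ) : Prop :=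
  DifferentiableOn ℂ f W ∧ ∀ p ∈ W, IsNashAtPair m W f p

/-- Partial derivative in the variable `z_i` of a function of `(z, w)`. -/
noncomputable def pderivZ (m : ℕ) (F : (Fin m → ℂ) × (Fin m → ℂ) → ℂ) (i : Fin m) :
    (Fin m → ℂ) × (Fin m → ℂ) → ℂ :=
  fun p => fderiv ℂ F p (Pi.single i 1, 0)

/-- Partial derivative in the variable `w_j` of a function of `(z, w)`. -/
noncomputable def pderivW (m : ℕ) (F : (Fin m → ℂ) × (Fin m → ℂ) → ℂ) (j : Fin m) :
    (Fin m → ℂ) × (Fin m → ℂ) → ℂ :=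
  fun p => fderiv ℂ F p (0, Pi.single j 1)

/-- Entry `(i,j)` of the mixed complex Hessian of `log Φ`:
`g^Φ_{ij} = Φ⁻¹ ∂²Φ/∂z_i∂w_j − Φ⁻² (∂Φ/∂z_i)(∂Φ/∂w_j)`. -/
noncomputable def gMat (m : ℕ) (Φ : (Fin m → ℂ) × (Fin m → ℂ) → ℂ) (i j : Fin m) :
    (Fin m → ℂ) × (Fin m → ℂ) → ℂ :=
  fun p => (Φ p)⁻¹ * pderivZ m (pderivW m Φ j) i p -
    ((Φ p) ^ 2)⁻¹ * pderivZ m Φ i p * pderivW m Φ j p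

/-- `D^Φ = det (g^Φ_{ij})`, the determinant of the mixed complex Hessian of `log Φ`. -/
noncomputable def detG (m : ℕ) (Φ : (Fin m → ℂ) × (Fin m → ℂ) → ℂ) :
    (Fin m → ℂ) × (Fin m → ℂ) → ℂ :=
  fun p => Matrix.det (Matrix.of fun i j : Fin m => gMat m Φ i j p)

/-- Entry `(i,j)` of the Ricci matrix: `Ric_{ij} = −g^{D^Φ}_{ij}`. -/
noncomputable def ricMat (m : ℕ) (Φ : (Fin m → ℂ) × (Fin m → ℂ) → ℂ) (i j : Fin m) :
    (Fin m → ℂ) × (Fin m → ℂ) → ℂ :=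
  fun p => -(gMat m (detG m Φ) i j p)

/-- The Euclidean Laplacian of a real-valued function on `ℂ ≅ ℝ²`. -/
noncomputable def lap (v : ℂ → ℝ) (s : ℂ) : ℝ :=
  fderiv ℝ (fun t => fderiv ℝ v t 1) s 1 +
    fderiv ℝ (fun t => fderiv ℝ v t Complex.I) s Complex.I

set_option linter.all false

section

/-- Galois averaging. -/
lemma galois_avg {K L : Type*} [Field K] [Field L] [Differential K] [Differential L]
    [Algebra K L] [DifferentialAlgebra K L] [CharZero K] [FiniteDimensional K L] [IsGalois K L]
    {ι : Type*} [Fintype ι] (a : K) (c : ι → K) (u : ι → L)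
    (h : algebraMap K L a = ∑ i, algebraMap K L (c i) * Differential.logDeriv (u i)) :
    ∃ (n : ℕ) (u₀ : ι → K), n ≠ 0 ∧ n * a = ∑ i, c i * Differential.logDeriv (u₀ i) := by
  let u₁ (i : ι) := ∏ x : (L ≃ₐ[K] L), x (u i)
  have key : ∀ i, u₁ i ∈ IntermediateField.fixedField (⊤ : Subgroup (L ≃ₐ[K] L)) := by
    rintro i ⟨e, _⟩
    change e (u₁ i) = u₁ i
    simp only [u₁, map_prod]
    apply Fintype.prod_equiv (Equiv.mulLeft e)
    simp
  have ffb : IntermediateField.fixedField (⊤ : Subgroup (L ≃ₐ[K] L)) = ⊥ :=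
    (IsGalois.tfae.out 0 1).mp (inferInstance : IsGalois K L)
  simp_rw [ffb, IntermediateField.mem_bot, Set.mem_range] at key
  choose u₀ hu₀ using key
  refine ⟨Fintype.card (L ≃ₐ[K] L), u₀, Fintype.card_ne_zero, ?_⟩
  apply FaithfulSMul.algebraMap_injective K L
  simp only [map_sum, map_mul, ← Differential.logDeriv_algebraMap, hu₀, map_natCast]
  have h1 : ∀ i, Differential.logDeriv (u₁ i) = ∑ x : (L ≃ₐ[K] L), Differential.logDeriv (x (u i)) := by
    intro i
    by_cases h : u i = 0 <;> simp [u₁, Differential.logDeriv_prod, h]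
  simp_rw [h1, Finset.mul_sum]
  rw [Finset.sum_comm]
  trans ∑ _ : (L ≃ₐ[K] L), algebraMap K L a
  · simp
  · refine Finset.sum_congr rfl fun e _ => ?_
    have := congrArg e h
    simp only [AlgEquiv.commutes, map_sum, map_mul] at this
    rw [this]
    refine Finset.sum_congr rfl fun i _ => ?_
    simp [Differential.logDeriv, Differential.algEquiv_deriv']


lemma alg_avg {K F : Type*} [Field K] [Field F] [Differential K] [Differential F]
    [Algebra K F] [DifferentialAlgebra K F] [CharZero K]
    {ι : Type*} [Fintype ι] (a : K) (c : ι → K) (u : ι → F) (hu : ∀ i, IsAlgebraic K (u i))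
    (h : algebraMap K F a = ∑ i, algebraMap K F (c i) * Differential.logDeriv (u i)) :
    ∃ (n : ℕ) (u₀ : ι → K), n ≠ 0 ∧ n * a = ∑ i, c i * Differential.logDeriv (u₀ i) := by
  let L := IntermediateField.adjoin K (Set.range u)
  have : FiniteDimensional K L := by
    apply IntermediateField.finiteDimensional_adjoin
    rintro x ⟨i, rfl⟩
    exact (hu i).isIntegral
  let v : ι → L := fun i => ⟨u i, IntermediateField.subset_adjoin _ _ ⟨i, rfl⟩⟩
  have hv : algebraMap K L a = ∑ i, algebraMap K L (c i) * Differential.logDeriv (v i) := by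
    apply FaithfulSMul.algebraMap_injective L F
    simp only [map_sum, map_mul, ← Differential.logDeriv_algebraMap, ← IsScalarTower.algebraMap_apply]
    exact h
  let m : L →ₐ[K] AlgebraicClosure L := IsScalarTower.toAlgHom K L (AlgebraicClosure L)
  let N := IntermediateField.normalClosure K L (AlgebraicClosure L)
  have : IsGalois K N := { }
  let j : L →ₐ[K] N := (Algebra.ofId L N).restrictScalars K
  apply galois_avg (L := N) a c (fun i => j (v i))
  have := congrArg j hv
  simp only [AlgHom.commutes, map_sum, map_mul] at this
  rw [this]
  refine Finset.sum_congr rfl fun i _ => ?_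
  simp [Differential.logDeriv, Differential.algHom_deriv' j j.injective]

end

section

/-- The field of constants of a derivation. -/
def constField {F : Type*} [Field F] (D : Derivation ℤ F F) : Subfield F where
  carrier := {x | D x = 0}
  mul_mem' := by
    intro a b ha hb
    simp only [Set.mem_ofPred_eq] at *
    simp [Derivation.leibniz, ha, hb]
  one_mem' := by simp
  add_mem' := by
    intro a b ha hb
    simp only [Set.mem_ofPred_eq] at *
    simp [ha, hb]
  zero_mem' := by simp
  neg_mem' := by
    intro a ha
    simp only [Set.mem_ofPred_eq] at *
    simp [ha]
  inv_mem' := by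
    intro a ha
    simp only [Set.mem_ofPred_eq] at *
    simp [Derivation.leibniz_inv, ha]

lemma mem_constField {F : Type*} [Field F] {D : Derivation ℤ F F} {x : F} :
    x ∈ constField D ↔ D x = 0 := Iff.rfl

lemma deriv_aeval_const {F : Type*} [Field F] (D : Derivation ℤ F F) (B : F)
    (p : Polynomial (constField D)) :
    D (Polynomial.aeval B p) = Polynomial.aeval B (Polynomial.derivative p) * D B := by
  induction p using Polynomial.induction_on' with
  | add p q hp hq => simp [hp, hq, add_mul]
  | monomial n a =>
    have ha : D (a : F) = 0 := a.2
    simp only [Polynomial.aeval_monomial, Polynomial.derivative_monomial, Derivation.leibniz,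
      Derivation.leibniz_pow]
    have : (algebraMap (constField D) F a) = (a : F) := rfl
    simp only [this, ha, map_mul, map_natCast]
    simp
    ring

lemma transcendental_of_deriv {F : Type*} [Field F] [CharZero F] (D : Derivation ℤ F F) (B : F)
    (hB : D B ≠ 0) : Transcendental (constField D) B := by
  intro h
  have h1 := deriv_aeval_const D B (minpoly (constField D) B)
  rw [minpoly.aeval] at h1
  simp only [map_zero, zero_eq_mul, hB, or_false] at h1
  have hpos := minpoly.natDegree_pos h.isIntegral
  have hsep := (minpoly.irreducible h.isIntegral).separable
  exact hsep.aeval_derivative_ne_zero (minpoly.aeval _ _) h1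

/-- degree argument in a polynomial ring -/
lemma poly_logDeriv {C ι : Type*} [Field C] [Fintype ι] [DecidableEq ι] (c : ι → C)
    (p : ι → Polynomial C) (hp : ∀ i, p i ≠ 0) (d : C)
    (h : ∑ i, Polynomial.C (c i) * (Polynomial.derivative (p i) *
      ∏ j ∈ Finset.univ.erase i, p j) = Polynomial.C d * ∏ j, p j) : d = 0 := by
  by_contra hd
  have hprod : (∏ j, p j) ≠ 0 := Finset.prod_ne_zero_iff.2 fun i _ => hp i
  have h1 : (Polynomial.C d * ∏ j, p j).degree = (∏ j, p j).degree := by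
    rw [Polynomial.degree_C_mul hd]
  have hlt : (∑ i, Polynomial.C (c i) * (Polynomial.derivative (p i) *
      ∏ j ∈ Finset.univ.erase i, p j)).degree < (∏ j, p j).degree := by
    refine (Polynomial.degree_sum_le _ _).trans_lt ?_
    rw [Finset.sup_lt_iff (by rw [bot_lt_iff_ne_bot]; simpa [Polynomial.degree_eq_bot] using hprod)]
    intro i _
    rw [← Finset.mul_prod_erase Finset.univ p (Finset.mem_univ i)]
    have h2 : (∏ j ∈ Finset.univ.erase i, p j) ≠ 0 := Finset.prod_ne_zero_iff.2 fun i _ => hp i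
    rw [← Polynomial.smul_eq_C_mul]
    refine lt_of_le_of_lt (Polynomial.degree_smul_le _ _) ?_
    rw [Polynomial.degree_mul, Polynomial.degree_mul]
    have := Polynomial.degree_derivative_lt (hp i)
    have h3 : (∏ j ∈ Finset.univ.erase i, p j).degree ≠ ⊥ := by
      simpa [Polynomial.degree_eq_bot] using h2
    exact WithBot.add_lt_add_right h3 this
  rw [h, h1] at hlt
  exact lt_irrefl _ hlt

lemma poly_logDeriv_field {F ι : Type*} [Field F] [CharZero F] [Fintype ι]
    (D : Derivation ℤ F F) (B : F) (hB : D B = 1)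
    (c : ι → constField D) (p : ι → Polynomial (constField D)) (hp : ∀ i, p i ≠ 0)
    (d : constField D)
    (h : ∑ i, (c i : F) * (D (Polynomial.aeval B (p i)) / Polynomial.aeval B (p i)) = d) :
    d = 0 := by
  classical
  have hT := transcendental_of_deriv D B (by simp [hB])
  have hne : ∀ i, Polynomial.aeval B (p i) ≠ 0 := fun i h0 =>
    hp i ((transcendental_iff_injective.1 hT) (by simpa using h0))
  apply poly_logDeriv c p hp d
  apply transcendental_iff_injective.1 hT
  simp only [map_sum, map_mul, map_prod, Polynomial.aeval_C]
  have e : ∀ x : constField D, algebraMap (constField D) F x = (x : F) := fun x => rfl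
  rw [e, ← h, Finset.sum_mul]
  refine Finset.sum_congr rfl fun i _ => ?_
  rw [deriv_aeval_const, hB, e, ← Finset.mul_prod_erase Finset.univ _ (Finset.mem_univ i)]
  field_simp [hne i]

open IntermediateField in
lemma deriv_mem_adjoin {F : Type*} [Field F] (D : Derivation ℤ F F) (B : F) (hB : D B = 1)
    (x : F) (hx : x ∈ (constField D)⟮B⟯) : D x ∈ (constField D)⟮B⟯ := by
  obtain ⟨r, s, rfl⟩ := IntermediateField.mem_adjoin_simple_iff _ _ |>.1 hx
  rw [Derivation.leibniz_div, deriv_aeval_const, deriv_aeval_const, hB]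
  have hm : ∀ p : Polynomial (constField D), Polynomial.aeval B p ∈ (constField D)⟮B⟯ := fun p =>
    IntermediateField.algebra_adjoin_le_adjoin _ _ (Polynomial.aeval_mem_adjoin_singleton _ B)
  simp only [smul_eq_mul, mul_one]
  exact mul_mem (pow_mem (inv_mem (hm _)) _) (sub_mem (mul_mem (hm _) (hm _)) (mul_mem (hm _) (hm _)))

open IntermediateField in
/-- The core Liouville-type obstruction. -/
lemma liouville_core {F ι : Type*} [Field F] [CharZero F] [Fintype ι]
    (D : Derivation ℤ F F) (B : F) (hB : D B = 1)
    (c : ι → constField D) (u : ι → F) (hu : ∀ i, IsAlgebraic (constField D)⟮B⟯ (u i)) :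
    ∑ i, (c i : F) * (D (u i) / u i) ≠ 1 := by
  intro h
  let K := (constField D)⟮B⟯
  letI : Differential F := ⟨D⟩
  letI : Differential K := ⟨Derivation.mk' (AddMonoidHom.toIntLinearMap
    { toFun := fun x => (⟨D x, deriv_mem_adjoin D B hB x x.2⟩ : K)
      map_zero' := by ext; simp
      map_add' := by intro x y; ext; simp }) (by intro a b; ext; simp)⟩
  have : DifferentialAlgebra K F := ⟨fun a => rfl⟩
  obtain ⟨n, u₀, hn, hu₀⟩ := alg_avg (K := K) (F := F) 1 (fun i => algebraMap _ K (c i)) u hu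
    (by rw [map_one]; exact h.symm)
  have h2 : (n : F) = ∑ i, (c i : F) * (D (u₀ i) / (u₀ i : F)) := by
    have := congrArg (algebraMap K F) hu₀
    simp only [map_mul, map_natCast, map_one, mul_one, map_sum,
      ← Differential.logDeriv_algebraMap] at this
    exact this
  choose r s hrs using fun i => (IntermediateField.mem_adjoin_simple_iff _ _).1 (u₀ i).2
  classical
  have hT := transcendental_of_deriv D B (by simp [hB])
  have hz : ∀ p : Polynomial (constField D), Polynomial.aeval B p = 0 → p = 0 := fun p h0 =>
    ((transcendental_iff_injective.1 hT) (by simpa using h0))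
  let r' : ι → Polynomial (constField D) := fun i => if r i = 0 ∨ s i = 0 then 1 else r i
  let s' : ι → Polynomial (constField D) := fun i => if r i = 0 ∨ s i = 0 then 1 else s i
  have hr' : ∀ i, r' i ≠ 0 := by
    intro i; simp only [r']; split_ifs with h
    · exact one_ne_zero
    · tauto
  have hs' : ∀ i, s' i ≠ 0 := by
    intro i; simp only [s']; split_ifs with h
    · exact one_ne_zero
    · tauto
  have key : ∀ i, D (u₀ i) / (u₀ i : F) =
      D (Polynomial.aeval B (r' i)) / Polynomial.aeval B (r' i) -
      D (Polynomial.aeval B (s' i)) / Polynomial.aeval B (s' i) := by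
    intro i
    simp only [r', s']
    split_ifs with h
    · rw [hrs i]
      rcases h with h | h <;> simp [h]
    · push Not at h
      rw [hrs i, Derivation.leibniz_div]
      have h1 : Polynomial.aeval B (r i) ≠ 0 := fun h0 => h.1 (hz _ h0)
      have h2 : Polynomial.aeval B (s i) ≠ 0 := fun h0 => h.2 (hz _ h0)
      simp only [smul_eq_mul]
      field_simp
  have := poly_logDeriv_field D B hB (ι := ι ⊕ ι) (Sum.elim c (fun i => - c i)) (Sum.elim r' s')
    (by rintro (i | i); exacts [hr' i, hs' i]) (n : constField D) (by
      rw [Fintype.sum_sum_type]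
      simp only [Sum.elim_inl, Sum.elim_inr]
      rw [← Finset.sum_add_distrib]
      push_cast
      rw [h2]
      refine Finset.sum_congr rfl fun i _ => ?_
      rw [key]; ring)
  exact hn (by exact_mod_cast this)

end

section

lemma derivation_extend_etale {R A B : Type*} [CommRing R] [CommRing A] [CommRing B] [Algebra R A]
    [Algebra R B] [Algebra A B] [IsScalarTower R A B] [Algebra.FormallyEtale A B]
    (d : Derivation R A B) : ∃ d' : Derivation R B B, ∀ a, d' (algebraMap A B a) = d a := by
  let e := KaehlerDifferential.tensorKaehlerEquivOfFormallyEtale R A B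
  let g := (d.liftKaehlerDifferential).liftBaseChange B
  refine ⟨(g ∘ₗ e.symm.toLinearMap).compDer (KaehlerDifferential.D R B), fun a => ?_⟩
  have h := KaehlerDifferential.tensorKaehlerEquivOfFormallyEtale_symm_D_algebraMap R A B a
  simp only [LinearMap.compDer, Derivation.coe_mk', LinearMap.coe_comp, LinearEquiv.coe_coe] 
  change g ((KaehlerDifferential.tensorKaehlerEquivOfFormallyEtale R A B).symm
      ((KaehlerDifferential.D R B) ((algebraMap A B) a))) = _
  rw [h]
  simp [g]

lemma exists_wild_derivation {k M : Type*} [Field k] [Field M] [CharZero k] [Algebra k M] (f : M)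
    (hf : Transcendental k f) :
    ∃ δ : Derivation k M M, δ f = 1 ∧ ∃ s : Set M, (∀ x ∈ s, x = f ∨ δ x = 0) ∧
      ∀ x : M, IsAlgebraic (Algebra.adjoin k s) x := by
  classical
  have : CharZero M := charZero_of_injective_algebraMap (algebraMap k M).injective
  obtain ⟨s, hs, hb⟩ := exists_isTranscendenceBasis_superset (R := k) (s := {f}) (by
    have := (algebraicIndependent_unique_type_iff (ι := ({f} : Set M)) (R := k)
      (x := Subtype.val)).2 (by simpa using hf)
    exact this)
  letI : Algebra (MvPolynomial s k) M := (MvPolynomial.aeval (Subtype.val : s → M)).toAlgebra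
  have hmap : ∀ p : MvPolynomial s k, algebraMap _ M p = MvPolynomial.aeval (Subtype.val : s → M) p :=
    fun _ => rfl
  haveI : IsScalarTower k (MvPolynomial s k) M := IsScalarTower.of_algebraMap_eq (fun x => by
    rw [hmap]; simp)
  haveI : FaithfulSMul (MvPolynomial s k) M := (faithfulSMul_iff_algebraMap_injective _ _).2 hb.1
  letI := FractionRing.liftAlgebra (MvPolynomial s k) M
  haveI := FractionRing.isScalarTower_liftAlgebra (MvPolynomial s k) M
  have halg : ∀ x : M, IsAlgebraic (Algebra.adjoin k s) x := by
    have := hb.isAlgebraic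
    rw [Subtype.range_coe] at this
    exact this.isAlgebraic
  haveI : Algebra.IsAlgebraic (MvPolynomial s k) M := by
    constructor
    intro x
    obtain ⟨P, hP, hP0⟩ := hb.isAlgebraic.isAlgebraic x
    refine ⟨P.map hb.1.aevalEquiv.symm.toRingEquiv.toRingHom, ?_, ?_⟩
    · exact (Polynomial.map_ne_zero_iff hb.1.aevalEquiv.symm.injective).2 hP
    · rw [Polynomial.aeval_def, Polynomial.eval₂_map, ← hP0, Polynomial.aeval_def]
      congr 1
      ext y
      obtain ⟨z, rfl⟩ := hb.1.aevalEquiv.surjective y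
      have := hb.1.algebraMap_aevalEquiv z
      rw [this, ← hmap]
      simp
  haveI : Algebra.IsAlgebraic (FractionRing (MvPolynomial s k)) M :=
    Algebra.IsAlgebraic.extendScalars (R := MvPolynomial s k) (IsFractionRing.injective _ _)
  haveI : Algebra.FormallyEtale (FractionRing (MvPolynomial s k)) M :=
    Algebra.FormallyEtale.of_isSeparable _ _
  haveI : Algebra.FormallyEtale (MvPolynomial s k) (FractionRing (MvPolynomial s k)) :=
    Algebra.FormallyEtale.of_isLocalization (nonZeroDivisors (MvPolynomial s k))
  haveI : Algebra.FormallyEtale (MvPolynomial s k) M :=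
    Algebra.FormallyEtale.comp _ (FractionRing (MvPolynomial s k)) _
  obtain ⟨δ, hδ⟩ := derivation_extend_etale (R := k)
    (MvPolynomial.mkDerivation k (fun i : s => if (i : M) = f then (1 : M) else 0))
  have key : ∀ x : s, δ x = if (x : M) = f then (1 : M) else 0 := by
    intro x
    have := hδ (MvPolynomial.X x)
    rw [hmap, MvPolynomial.aeval_X, MvPolynomial.mkDerivation_X] at this
    exact this
  refine ⟨δ, ?_, s, ?_, halg⟩
  · simpa using key ⟨f, hs rfl⟩
  · intro x hx
    by_cases h : x = f
    · exact Or.inl h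
    · right; simpa [h] using key ⟨x, hx⟩

open IntermediateField in
lemma isAlgebraic_exchange {C F : Type*} [Field C] [Field F] [Algebra C F] (B f : F)
    (hB : Transcendental C B) (h : IsAlgebraic C⟮f⟯ B) : IsAlgebraic C⟮B⟯ f := by
  rw [isAlgebraic_adjoin_iff] at h ⊢
  have := Matroid.mem_closure_insert (M := AlgebraicIndependent.matroid C F) (X := ∅) (e := B)
    (f := f)
  simp only [AlgebraicIndependent.matroid_closure_eq, SetLike.mem_coe, Subalgebra.mem_algebraicClosure,
    Algebra.adjoin_empty, insert_empty_eq] at this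
  refine this ?_ h
  intro h2
  apply hB
  rw [Algebra.adjoin_empty] at h2
  exact Subalgebra.isAlgebraic_of_isAlgebraic_bot h2

end

section

lemma isAlgebraic_aeval_of {K F : Type*} [Field K] [Field F] [Algebra K F] {a : F}
    (ha : IsAlgebraic K a) (p : Polynomial K) : IsAlgebraic K (Polynomial.aeval a p) := by
  induction p using Polynomial.induction_on' with
  | add p q hp hq => rw [map_add]; exact hp.add hq
  | monomial n b => rw [Polynomial.aeval_monomial]; exact (isAlgebraic_algebraMap b).mul (ha.pow n)

open IntermediateField in
lemma deriv_algebraic {F : Type*} [Field F] [CharZero F] (D : Derivation ℤ F F) (B : F)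
    (hB : D B = 1) (a : F) (ha : IsAlgebraic (constField D)⟮B⟯ a) :
    IsAlgebraic (constField D)⟮B⟯ (D a) := by
  set K := (constField D)⟮B⟯
  have key : ∀ p : Polynomial K, ∃ q : Polynomial K, D (Polynomial.aeval a p) =
      Polynomial.aeval a q + Polynomial.aeval a (Polynomial.derivative p) * D a := by
    intro p
    induction p using Polynomial.induction_on' with
    | add p q hp hq =>
      obtain ⟨p', hp⟩ := hp
      obtain ⟨q', hq⟩ := hq
      exact ⟨p' + q', by simp only [map_add, hp, hq]; ring⟩
    | monomial n b =>
      refine ⟨Polynomial.monomial n ⟨D b, deriv_mem_adjoin D B hB b b.2⟩, ?_⟩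
      simp only [Polynomial.aeval_monomial, Polynomial.derivative_monomial, Derivation.leibniz,
        Derivation.leibniz_pow]
      have : ∀ b : K, (algebraMap K F b) = (b : F) := fun _ => rfl
      simp only [← this, map_mul, map_natCast, smul_eq_mul, nsmul_eq_mul]
      simp only [this]
      ring
  obtain ⟨q, hq⟩ := key (minpoly K a)
  have hsep := (minpoly.irreducible ha.isIntegral).separable
  have hne : Polynomial.aeval a (Polynomial.derivative (minpoly K a)) ≠ 0 :=
    hsep.aeval_derivative_ne_zero (minpoly.aeval _ _)
  rw [minpoly.aeval, map_zero] at hq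
  have hA : ∀ p : Polynomial K, Polynomial.aeval a p ∈ algebraicClosure K F := fun p => by
    apply mem_algebraicClosure_iff.2
    exact isAlgebraic_aeval_of ha p
  have : D a = - Polynomial.aeval a q / Polynomial.aeval a (Polynomial.derivative (minpoly K a)) := by
    field_simp
    linear_combination -hq
  rw [this]
  exact mem_algebraicClosure_iff.1 (div_mem (neg_mem (hA _)) (hA _))

lemma poly_lead {A : Type*} [Field A] (P Q : Polynomial A) (hP : P ≠ 0) (hQ : Q ≠ 0) (κ θ : A)
    (h : Polynomial.C κ * (P * Q) = Polynomial.C θ * ((Polynomial.X * Polynomial.derivative P) * Q -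
      P * (Polynomial.X * Polynomial.derivative Q))) :
    κ = θ * ((P.natDegree : A) - Q.natDegree) := by
  have hdeg : ∀ P : Polynomial A, (Polynomial.X * Polynomial.derivative P).natDegree ≤ P.natDegree ∧
      (Polynomial.X * Polynomial.derivative P).coeff P.natDegree = P.natDegree * P.leadingCoeff := by
    intro P
    rcases Nat.eq_zero_or_pos P.natDegree with h0 | h0
    · rw [Polynomial.eq_C_of_natDegree_eq_zero h0]; simp
    · refine ⟨?_, ?_⟩
      · refine Polynomial.natDegree_mul_le.trans ?_
        have := Polynomial.natDegree_derivative_le P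
        rw [Polynomial.natDegree_X]; omega
      · obtain ⟨n, hn⟩ : ∃ n, P.natDegree = n + 1 := ⟨P.natDegree - 1, by omega⟩
        rw [hn, Polynomial.coeff_X_mul, Polynomial.coeff_derivative, Polynomial.leadingCoeff, hn]
        push_cast; ring
  have h2 := congrArg (fun p => Polynomial.coeff p (P.natDegree + Q.natDegree)) h
  simp only [Polynomial.coeff_C_mul, Polynomial.coeff_sub] at h2
  rw [Polynomial.coeff_mul_add_eq_of_natDegree_le le_rfl le_rfl,
    Polynomial.coeff_mul_add_eq_of_natDegree_le (hdeg P).1 le_rfl,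
    Polynomial.coeff_mul_add_eq_of_natDegree_le le_rfl (hdeg Q).1, (hdeg P).2, (hdeg Q).2] at h2
  have hp := Polynomial.leadingCoeff_ne_zero.2 hP
  have hq := Polynomial.leadingCoeff_ne_zero.2 hQ
  simp only [Polynomial.coeff_natDegree] at h2
  apply mul_right_cancel₀ (mul_ne_zero hp hq)
  linear_combination h2

open IntermediateField in
lemma core_field {F : Type*} [Field F] [CharZero F] (D : Derivation ℤ F F) (B : F)
    (hB : D B = 1) (a1 b1 a2 b2 b3 y0 g R y : F) (P Q : Polynomial (constField D))
    (ha1 : IsAlgebraic (constField D)⟮B⟯ a1) (hb1 : IsAlgebraic (constField D)⟮B⟯ b1)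
    (ha2 : IsAlgebraic (constField D)⟮B⟯ a2) (hb2 : IsAlgebraic (constField D)⟮B⟯ b2)
    (hb3 : IsAlgebraic (constField D)⟮B⟯ b3) (hy0 : IsAlgebraic (constField D)⟮B⟯ y0)
    (hg : IsAlgebraic (constField D)⟮B⟯ g) (hy : y ≠ 0)
    (hP : Polynomial.aeval (g * y) P ≠ 0) (hQ : Polynomial.aeval (g * y) Q ≠ 0)
    (hR : R * Polynomial.aeval (g * y) Q = Polynomial.aeval (g * y) P)
    (c1 c2 c3 l : constField D)
    (h1 : c1 * (D a1 / a1 - D b1 / b1) + c2 * (D a2 / a2 - D b2 / b2) +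
      c3 * (D R / R - D b3 / b3) = 1)
    (h2 : D y / y = l * (D a2 / a2 - D b2 / b2) + D y0 / y0) : False := by
  set K := (constField D)⟮B⟯ with hK
  have hR' : R = Polynomial.aeval (g * y) P / Polynomial.aeval (g * y) Q := by
    rw [← hR]; field_simp
  have hDR : D R / R = D (Polynomial.aeval (g * y) P) / Polynomial.aeval (g * y) P -
      D (Polynomial.aeval (g * y) Q) / Polynomial.aeval (g * y) Q := by
    rw [hR', Derivation.leibniz_div]
    simp only [smul_eq_mul]
    field_simp
  by_cases hx : IsAlgebraic K (g * y)
  · have hpoly : ∀ p : Polynomial (constField D), IsAlgebraic K (Polynomial.aeval (g * y) p) := by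
      intro p
      have := isAlgebraic_aeval_of hx (p.map (algebraMap (constField D) K))
      rwa [Polynomial.aeval_map_algebraMap] at this
    refine liouville_core D B hB (ι := Fin 7) ![c1, -c1, c2, -c2, c3, -c3, -c3]
      ![a1, b1, a2, b2, Polynomial.aeval (g * y) P, Polynomial.aeval (g * y) Q, b3] ?_ ?_
    · intro i; fin_cases i
      exacts [ha1, hb1, ha2, hb2, hpoly _, hpoly _, hb3]
    · rw [← h1, hDR]
      simp only [Fin.sum_univ_succ, Fin.sum_univ_zero]
      simp
      ring
  · have hg0 : g ≠ 0 := by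
      rintro rfl
      apply hx
      simpa using isAlgebraic_zero
    let A := algebraicClosure K F
    have hLD : ∀ a, IsAlgebraic K a → D a / a ∈ A := fun a ha =>
      div_mem (mem_algebraicClosure_iff.2 (deriv_algebraic D B hB a ha)) (mem_algebraicClosure_iff.2 ha)
    have hcA : ∀ c : constField D, (c : F) ∈ A := fun c =>
      A.algebraMap_mem (algebraMap (constField D) K c)
    have hxA : Transcendental A (g * y) := by
      intro h
      exact hx (h.restrictScalars K)
    set θ : F := D g / g + (l * (D a2 / a2 - D b2 / b2) + D y0 / y0) with hθ
    have hθA : θ ∈ A := add_mem (hLD _ hg) (add_mem (mul_mem (hcA _)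
      (sub_mem (hLD _ ha2) (hLD _ hb2))) (hLD _ hy0))
    have hDx : D (g * y) = θ * (g * y) := by
      rw [hθ, ← h2, Derivation.leibniz]
      simp only [smul_eq_mul]
      field_simp
      ring
    set κ : F := 1 - c1 * (D a1 / a1 - D b1 / b1) - c2 * (D a2 / a2 - D b2 / b2) +
      c3 * (D b3 / b3) with hκ
    have hκA : κ ∈ A := add_mem (sub_mem (sub_mem (one_mem _) (mul_mem (hcA _)
      (sub_mem (hLD _ ha1) (hLD _ hb1)))) (mul_mem (hcA _)
      (sub_mem (hLD _ ha2) (hLD _ hb2)))) (mul_mem (hcA _) (hLD _ hb3))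
    have hκR : κ = c3 * (D R / R) := by
      rw [hκ]; linear_combination -h1
    let φ : constField D →+* A := (algebraMap K A).comp (algebraMap (constField D) K)
    have hφ : ∀ p : Polynomial (constField D), Polynomial.aeval (g * y) (p.map φ) =
        Polynomial.aeval (g * y) p := by
      intro p
      rw [Polynomial.aeval_def, Polynomial.eval₂_map, Polynomial.aeval_def]
      rfl
    have hid := poly_lead (P.map φ) (Q.map φ)
      (fun h => hP (by rw [← hφ, h, map_zero])) (fun h => hQ (by rw [← hφ, h, map_zero]))
      ⟨κ, hκA⟩ (⟨c3 * θ, mul_mem (hcA _) hθA⟩) (by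
        apply transcendental_iff_injective.1 hxA
        simp only [map_mul, map_sub, Polynomial.derivative_map, hφ, Polynomial.aeval_C,
          Polynomial.aeval_X]
        change κ * _ = (c3 * θ) * _
        rw [hκR, hDR, deriv_aeval_const, deriv_aeval_const, hDx]
        field_simp)
    have hid2 : κ = c3 * θ * (((P.map φ).natDegree : F) - (Q.map φ).natDegree) := by
      have := congrArg (algebraMap A F) hid
      simpa using this
    set N : constField D := c3 * (((P.map φ).natDegree : constField D) - (Q.map φ).natDegree) with hN
    have hN' : (N : F) = c3 * (((P.map φ).natDegree : F) - (Q.map φ).natDegree) := by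
      rw [hN]; push_cast; ring
    refine liouville_core D B hB (ι := Fin 7) ![c1, -c1, c2 + N * l, -(c2 + N * l), -c3, N, N]
      ![a1, b1, a2, b2, b3, g, y0] ?_ ?_
    · intro i; fin_cases i
      exacts [ha1, hb1, ha2, hb2, hb3, hg, hy0]
    · have e : (1 : F) = κ + c1 * (D a1 / a1 - D b1 / b1) + c2 * (D a2 / a2 - D b2 / b2) -
        c3 * (D b3 / b3) := by rw [hκ]; ring
      rw [e, hid2, hθ]
      simp only [Fin.sum_univ_succ, Fin.sum_univ_zero]
      simp
      simp only [Polynomial.natDegree_map] at hN' ⊢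
      rw [hN']
      ring

end

section

lemma isAlgebraic_transfer {R S K F : Type*} [CommRing R] [CommRing S] [Field K] [Field F]
    [Algebra R S] [Algebra K F] (φ : S →+* F) (hφ : Function.Injective φ)
    (hR : Function.Injective (algebraMap R S))
    (h : ∀ r : R, IsAlgebraic K (φ (algebraMap R S r))) (x : S) (hx : IsAlgebraic R x) :
    IsAlgebraic K (φ x) := by
  let E := algebraicClosure K F
  let ψ : R →+* E := (φ.comp (algebraMap R S)).codRestrict E (fun r => mem_algebraicClosure_iff.2 (h r))
  have hψ : ∀ r, (ψ r : F) = φ (algebraMap R S r) := fun r => rfl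
  obtain ⟨P, hP, hP0⟩ := hx
  have h1 : IsAlgebraic E (φ x) := by
    refine ⟨P.map ψ, ?_, ?_⟩
    · refine (Polynomial.map_ne_zero_iff ?_).2 hP
      intro a b hab
      apply hR; apply hφ
      rw [← hψ, ← hψ, hab]
    · rw [Polynomial.aeval_def, Polynomial.eval₂_map]
      have := congrArg φ hP0
      rw [map_zero, Polynomial.aeval_def, Polynomial.hom_eval₂] at this
      exact this
  exact h1.restrictScalars K

lemma isAlgebraic_adjoin_transfer {k S K F : Type*} [CommRing k] [CommRing S] [Field K] [Field F]
    [Algebra k S] [Algebra K F] (φ : S →+* F) (s : Set S)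
    (hk : ∀ c : k, IsAlgebraic K (φ (algebraMap k S c)))
    (h : ∀ x ∈ s, IsAlgebraic K (φ x)) (x : S) (hx : x ∈ Algebra.adjoin k s) :
    IsAlgebraic K (φ x) := by
  induction hx using Algebra.adjoin_induction with
  | mem x hx => exact h x hx
  | algebraMap r => exact hk r
  | add x y _ _ hx hy => rw [map_add]; exact hx.add hy
  | mul x y _ _ hx hy => rw [map_mul]; exact hx.mul hy

open PowerSeries in
/-- coefficientwise extension of a derivation to power series -/
noncomputable def coeffDer {k M : Type*} [Field k] [Field M] [Algebra k M] (δ : Derivation k M M) :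
    Derivation k M⟦X⟧ M⟦X⟧ :=
  Derivation.mk' (A := M⟦X⟧) (M := M⟦X⟧)
    { toFun := fun f => PowerSeries.mk (fun n => δ (coeff n f))
      map_add' := by intro f g; ext n; simp
      map_smul' := by intro c f; ext n; simp [coeff_mk]  }
    (by
      intro a b
      ext n
      simp only [LinearMap.coe_mk, AddHom.coe_mk, coeff_mk, smul_eq_mul, map_add, coeff_mul, map_sum,
        Derivation.leibniz, Finset.sum_add_distrib]
      congr 1
      rw [← Finset.Nat.sum_antidiagonal_swap (n := n)]
      rfl)

open PowerSeries in
lemma coeff_coeffDer {k M : Type*} [Field k] [Field M] [Algebra k M] (δ : Derivation k M M)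
    (f : M⟦X⟧) (n : ℕ) : coeff n (coeffDer δ f) = δ (coeff n f) := by
  simp [coeffDer]

open PowerSeries in
lemma coeffDer_C {k M : Type*} [Field k] [Field M] [Algebra k M] (δ : Derivation k M M) (x : M) :
    coeffDer δ (C x) = C (δ x) := by
  ext n
  rw [coeff_coeffDer, coeff_C, coeff_C]
  split_ifs <;> simp

open PowerSeries in
lemma coeffDer_map {k M : Type*} [Field k] [Field M] [Algebra k M] (δ : Derivation k M M) (x : k⟦X⟧) :
    coeffDer δ (PowerSeries.map (algebraMap k M) x) = 0 := by
  ext n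
  rw [coeff_coeffDer, coeff_map]
  simp

open PowerSeries in
lemma coeffDer_comm {k M : Type*} [Field k] [Field M] [Algebra k M] (δ : Derivation k M M)
    (f : M⟦X⟧) : coeffDer δ (derivative M f) = derivative M (coeffDer δ f) := by
  ext n
  rw [coeff_coeffDer, coeff_derivative, coeff_derivative, coeff_coeffDer, Derivation.leibniz]
  have : δ ((n : M) + 1) = 0 := by
    rw [map_add, Derivation.map_one_eq_zero, Derivation.map_natCast, add_zero]
  rw [this]
  simp [mul_comm]

open PowerSeries in
lemma eq_C_of_derivative {M : Type*} [Field M] [CharZero M] (f : M⟦X⟧) (h : derivative M f = 0) :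
    f = C (constantCoeff f) := by
  apply derivative.ext
  · rw [h, derivative_C]
  · simp

open PowerSeries in
lemma logder_const {k M : Type*} [Field k] [Field M] [CharZero M] [Algebra k M] (δ : Derivation k M M)
    (L a : M⟦X⟧) (ha : constantCoeff a ≠ 0) (h : derivative M L * a = derivative M a) :
    coeffDer δ L - C (δ (constantCoeff L)) = a⁻¹ * coeffDer δ a -
      C (δ (constantCoeff a) / constantCoeff a) := by
  have hinv : a * a⁻¹ = 1 := PowerSeries.mul_inv_cancel a ha
  have hL : derivative M L = a⁻¹ * derivative M a := by
    rw [← h]; linear_combination (- derivative M L) * hinv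
  have h0 : derivative M (coeffDer δ L - a⁻¹ * coeffDer δ a) = 0 := by
    have h1 := congrArg (coeffDer δ) h
    simp only [Derivation.leibniz, coeffDer_comm, smul_eq_mul] at h1
    rw [map_sub, Derivation.leibniz, derivative_inv', smul_eq_mul, smul_eq_mul]
    rw [hL] at h1
    have h2 : derivative M (coeffDer δ L) = a⁻¹ * (derivative M (coeffDer δ a)
        - a⁻¹ * derivative M a * coeffDer δ a) := by
      rw [← h1]; linear_combination (- derivative M (coeffDer δ L)) * hinv
    rw [h2]; ring
  have h1 := eq_C_of_derivative _ h0
  have hc : ∀ f : M⟦X⟧, constantCoeff (coeffDer δ f) = δ (constantCoeff f) := by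
    intro f
    rw [← coeff_zero_eq_constantCoeff_apply, coeff_coeffDer, coeff_zero_eq_constantCoeff_apply]
  have h2 : constantCoeff (coeffDer δ L - a⁻¹ * coeffDer δ a) =
      δ (constantCoeff L) - δ (constantCoeff a) / constantCoeff a := by
    rw [map_sub, map_mul, hc, hc, PowerSeries.constantCoeff_inv]
    ring
  rw [h2, map_sub] at h1
  linear_combination h1

open PowerSeries IntermediateField in
lemma algebraic_core_aux {k M : Type*} (F : Type*) [Field k] [IsAlgClosed k] [Field M] [CharZero k] [Algebra k M]
    [Field F] [Algebra M⟦X⟧ F] [IsFractionRing M⟦X⟧ F] [Algebra k F] [IsScalarTower k M⟦X⟧ F]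
    (B L1 L2 L3 a1 a2 R y g : M⟦X⟧) (P Q : Polynomial k) (c1 c2 c3 l : k)
    (ha1 : constantCoeff a1 ≠ 0) (ha2 : constantCoeff a2 ≠ 0) (hR : constantCoeff R ≠ 0)
    (hy : constantCoeff y ≠ 0) (hQ : Polynomial.aeval (g * y) Q ≠ 0)
    (hRPQ : R * Polynomial.aeval (g * y) Q = Polynomial.aeval (g * y) P)
    (hL1 : derivative M L1 * a1 = derivative M a1) (hL2 : derivative M L2 * a2 = derivative M a2)
    (hL3 : derivative M L3 * R = derivative M R)
    (hyL : derivative M y = C (algebraMap k M l) * y * derivative M L2)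
    (hB0 : constantCoeff B = 0)
    (hBeq : derivative M (B - (C (algebraMap k M c1) * L1 + C (algebraMap k M c2) * L2 +
      C (algebraMap k M c3) * L3)) ∈ Set.range (PowerSeries.map (algebraMap k M)))
    (S0 : Subalgebra M M⟦X⟧)
    (hS0 : S0 = Algebra.adjoin M (Set.range (PowerSeries.map (algebraMap k M))))
    (h1 : IsAlgebraic S0 a1) (h2 : IsAlgebraic S0 a2) (hg : g ∈ S0) (hB : B ∈ S0) :
    ∀ n, coeff n B ∈ Set.range (algebraMap k M) := by
  have : CharZero M := charZero_of_injective_algebraMap (algebraMap k M).injective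
  intro n
  by_contra hn
  have htr : Transcendental k (coeff n B) := by
    intro h
    apply hn
    have := IntermediateField.adjoin.finiteDimensional h.isIntegral
    haveI : Algebra.IsIntegral k k⟮coeff n B⟯ := Algebra.IsIntegral.of_finite _ _
    obtain ⟨z, hz⟩ := (IsAlgClosed.algebraMap_bijective_of_isIntegral (k := k)
      (K := k⟮coeff n B⟯)).2 ⟨coeff n B, mem_adjoin_simple_self _ _⟩
    exact ⟨z, by simpa using congrArg (algebraMap _ M) hz⟩
  obtain ⟨δ, hδf, s, hs, hsalg⟩ := exists_wild_derivation _ htr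
  set f := coeff n B with hf
  haveI : CharZero F := charZero_of_injective_algebraMap (algebraMap k F).injective
  let φ : M⟦X⟧ →+* F := algebraMap M⟦X⟧ F
  have hφ : Function.Injective φ := IsFractionRing.injective _ _
  haveI : Algebra.FormallyEtale M⟦X⟧ F :=
    Algebra.FormallyEtale.of_isLocalization (nonZeroDivisors M⟦X⟧)
  obtain ⟨δF, hδF⟩ := derivation_extend_etale (R := k) (A := M⟦X⟧) (B := F)
    ((Algebra.linearMap M⟦X⟧ F).compDer (coeffDer δ))
  replace hδF : ∀ a, δF (φ a) = φ (coeffDer δ a) := hδF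
  have hBne : coeffDer δ B ≠ 0 := by
    intro h
    have := coeff_coeffDer δ B n
    rw [h, ← hf, hδf] at this
    simp at this
  have hBne' : φ (coeffDer δ B) ≠ 0 := fun h => hBne (hφ (by rw [h, map_zero]))
  let D : Derivation ℤ F F := (φ (coeffDer δ B))⁻¹ • (δF.restrictScalars ℤ)
  have hD : ∀ a, D (φ a) = (φ (coeffDer δ B))⁻¹ * φ (coeffDer δ a) := by
    intro a
    rw [← hδF a]; rfl
  have hDB : D (φ B) = 1 := by rw [hD]; field_simp
  have hCconst : ∀ x : M, δ x = 0 → φ (C x) ∈ constField D := by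
    intro x hx
    rw [mem_constField, hD, coeffDer_C, hx]; simp
  have hmapconst : ∀ x : k⟦X⟧, φ (PowerSeries.map (algebraMap k M) x) ∈ constField D := by
    intro x
    rw [mem_constField, hD, coeffDer_map]; simp
  have hkconst : ∀ c : k, φ (C (algebraMap k M c)) ∈ constField D := fun c => hCconst _ (by simp)
  have halgC : ∀ (x z : F), x ∈ constField D → IsAlgebraic (constField D)⟮z⟯ x := by
    intro x z hx
    exact isAlgebraic_algebraMap (algebraMap (constField D) (constField D)⟮z⟯ ⟨x, hx⟩)
  have hMalg : ∀ z : F, IsAlgebraic (constField D)⟮z⟯ (φ (C f)) → ∀ x : M,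
      IsAlgebraic (constField D)⟮z⟯ (φ (C x)) := by
    intro z hz x
    refine isAlgebraic_transfer (R := Algebra.adjoin k s) (φ.comp (C : M →+* M⟦X⟧))
      (hφ.comp C_injective) Subtype.val_injective ?_ x (hsalg x)
    intro r
    refine isAlgebraic_adjoin_transfer (φ.comp (C : M →+* M⟦X⟧)) s ?_ ?_ r r.2
    · intro c
      exact halgC _ _ (hkconst c)
    · intro x hx
      rcases hs x hx with rfl | h0
      · exact hz
      · exact halgC _ _ (hCconst _ h0)
  have hSalg : ∀ z : F, IsAlgebraic (constField D)⟮z⟯ (φ (C f)) → ∀ x ∈ S0,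
      IsAlgebraic (constField D)⟮z⟯ (φ x) := by
    intro z hz x hx
    rw [hS0] at hx
    refine isAlgebraic_adjoin_transfer φ _ ?_ ?_ x hx
    · intro c; exact hMalg z hz c
    · rintro _ ⟨x, rfl⟩
      exact halgC _ _ (hmapconst x)
  have hBf : IsAlgebraic (constField D)⟮φ (C f)⟯ (φ B) := hSalg _
    (isAlgebraic_algebraMap (⟨φ (C f), mem_adjoin_simple_self _ _⟩ : (constField D)⟮φ (C f)⟯)) B hB
  have hBtr : Transcendental (constField D) (φ B) :=
    transcendental_of_deriv D _ (by rw [hDB]; exact one_ne_zero)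
  have hfB := isAlgebraic_exchange _ _ hBtr hBf
  have hM' := hMalg _ hfB
  have hS' := hSalg _ hfB
  have hS'' : ∀ x, IsAlgebraic S0 x → IsAlgebraic (constField D)⟮φ B⟯ (φ x) := fun x hx =>
    isAlgebraic_transfer (R := S0) φ hφ Subtype.val_injective (fun r => hS' r r.2) x hx
  -- the identities
  have hdC : ∀ (c : k) (x : M⟦X⟧), coeffDer δ (C (algebraMap k M c) * x) =
      C (algebraMap k M c) * coeffDer δ x := by
    intro c x
    rw [Derivation.leibniz, coeffDer_C]; simp
  have hdC' : ∀ (c : k) (x : M⟦X⟧), derivative M (C (algebraMap k M c) * x) =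
      C (algebraMap k M c) * derivative M x := by
    intro c x
    rw [Derivation.leibniz, derivative_C]; simp
  have i1 := logder_const δ L1 a1 ha1 hL1
  have i2 := logder_const δ L2 a2 ha2 hL2
  have i3 := logder_const δ L3 R hR hL3
  have i4 := logder_const δ (C (algebraMap k M l) * L2) y hy (by rw [hdC', hyL]; ring)
  have hc0 : ∀ f : M⟦X⟧, constantCoeff (coeffDer δ f) = δ (constantCoeff f) := by
    intro f
    rw [← coeff_zero_eq_constantCoeff_apply, coeff_coeffDer, coeff_zero_eq_constantCoeff_apply]
  have hdk : ∀ (c : k) (x : M), δ (algebraMap k M c * x) = algebraMap k M c * δ x := by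
    intro c x
    rw [Derivation.leibniz]; simp
  have i5 : coeffDer δ B = C (algebraMap k M c1) * (coeffDer δ L1 - C (δ (constantCoeff L1))) +
      C (algebraMap k M c2) * (coeffDer δ L2 - C (δ (constantCoeff L2))) +
      C (algebraMap k M c3) * (coeffDer δ L3 - C (δ (constantCoeff L3))) := by
    obtain ⟨w, hw⟩ := hBeq
    have h0 := coeffDer_map δ w
    rw [hw, coeffDer_comm] at h0
    have h3 := eq_C_of_derivative _ h0
    rw [hc0, map_sub, map_sub, hB0, zero_sub] at h3
    simp only [map_add, map_mul, hdC, constantCoeff_C, hdk, map_neg] at h3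
    linear_combination h3
  have nz : ∀ a : M⟦X⟧, constantCoeff a ≠ 0 → φ a ≠ 0 := by
    intro a ha h
    have : a = 0 := hφ (by rw [h, map_zero])
    rw [this] at ha; simp at ha
  have ninv : ∀ a : M⟦X⟧, constantCoeff a ≠ 0 → φ (a⁻¹) = (φ a)⁻¹ := by
    intro a ha
    apply eq_inv_of_mul_eq_one_left
    rw [← map_mul, PowerSeries.inv_mul_cancel a ha, map_one]
  have hLD : ∀ a : M⟦X⟧, constantCoeff a ≠ 0 →
      φ (a⁻¹ * coeffDer δ a - C (δ (constantCoeff a) / constantCoeff a)) = φ (coeffDer δ B) *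
      (D (φ a) / φ a - D (φ (C (constantCoeff a))) / φ (C (constantCoeff a))) := by
    intro a ha
    have e : φ (C (δ (constantCoeff a) / constantCoeff a)) = φ (C (δ (constantCoeff a))) /
        φ (C (constantCoeff a)) := by
      have := map_div₀ (φ.comp (C : M →+* M⟦X⟧)) (δ (constantCoeff a)) (constantCoeff a)
      exact this
    rw [map_sub, map_mul, ninv a ha, hD, hD, coeffDer_C, e]
    have := nz a ha
    have h2 : φ (C (constantCoeff a)) ≠ 0 := nz _ (by simpa using ha)
    field_simp
  let ψ : k →+* constField D := (φ.comp ((C : M →+* M⟦X⟧).comp (algebraMap k M))).codRestrict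
    (constField D) hkconst
  have hψ : ∀ p : Polynomial k, Polynomial.aeval (φ g * φ y) (p.map ψ) =
      φ (Polynomial.aeval (g * y) p) := by
    intro p
    rw [Polynomial.aeval_def, Polynomial.eval₂_map, Polynomial.aeval_def, Polynomial.hom_eval₂,
      map_mul]
    congr 1
    ext c
    simp only [RingHom.comp_apply]
    rw [PowerSeries.algebraMap_apply]
    rfl
  have hQ' : φ (Polynomial.aeval (g * y) Q) ≠ 0 := fun h => hQ (hφ (by rw [h, map_zero]))
  refine core_field D (φ B) hDB (φ a1) (φ (C (constantCoeff a1))) (φ a2) (φ (C (constantCoeff a2)))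
    (φ (C (constantCoeff R))) (φ (C (constantCoeff y))) (φ g) (φ R) (φ y) (P.map ψ) (Q.map ψ)
    (hS'' _ h1) (hM' _) (hS'' _ h2) (hM' _) (hM' _) (hM' _) (hS' _ hg) (nz _ hy)
    ?_ ?_ ?_ (ψ c1) (ψ c2) (ψ c3) (ψ l) ?_ ?_
  · rw [hψ, ← hRPQ, map_mul]
    exact mul_ne_zero (nz _ hR) hQ'
  · rw [hψ]; exact hQ'
  · rw [hψ, hψ, ← hRPQ, map_mul]
  · have e := congrArg φ i5
    rw [i1, i2, i3] at e
    rw [map_add, map_add, map_mul, map_mul, map_mul, hLD _ ha1, hLD _ ha2, hLD _ hR] at e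
    have hψc : ∀ c, (ψ c : F) = φ (C (algebraMap k M c)) := fun c => rfl
    rw [hψc, hψc, hψc]
    apply mul_left_cancel₀ hBne'
    rw [mul_one]
    linear_combination -e
  · have hψc : ∀ c, (ψ c : F) = φ (C (algebraMap k M c)) := fun c => rfl
    rw [hψc]
    have e : C (algebraMap k M l) * (a2⁻¹ * coeffDer δ a2 -
      C (δ (constantCoeff a2) / constantCoeff a2)) = y⁻¹ * coeffDer δ y -
      C (δ (constantCoeff y) / constantCoeff y) := by
      rw [← i4, ← i2, hdC]
      simp only [map_mul, constantCoeff_C, hdk]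
      ring
    have e' := congrArg φ e
    rw [map_mul, hLD _ ha2, hLD _ hy] at e'
    apply mul_left_cancel₀ hBne'
    linear_combination -e'

open PowerSeries IntermediateField in
lemma algebraic_core {k M : Type*} [Field k] [IsAlgClosed k] [Field M] [CharZero k] [Algebra k M]
    (B L1 L2 L3 a1 a2 R y g : M⟦X⟧) (P Q : Polynomial k) (c1 c2 c3 l : k)
    (ha1 : constantCoeff a1 ≠ 0) (ha2 : constantCoeff a2 ≠ 0) (hR : constantCoeff R ≠ 0)
    (hy : constantCoeff y ≠ 0) (hQ : Polynomial.aeval (g * y) Q ≠ 0)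
    (hRPQ : R * Polynomial.aeval (g * y) Q = Polynomial.aeval (g * y) P)
    (hL1 : derivative M L1 * a1 = derivative M a1) (hL2 : derivative M L2 * a2 = derivative M a2)
    (hL3 : derivative M L3 * R = derivative M R)
    (hyL : derivative M y = C (algebraMap k M l) * y * derivative M L2)
    (hB0 : constantCoeff B = 0)
    (hBeq : derivative M (B - (C (algebraMap k M c1) * L1 + C (algebraMap k M c2) * L2 +
      C (algebraMap k M c3) * L3)) ∈ Set.range (PowerSeries.map (algebraMap k M)))
    (S0 : Subalgebra M M⟦X⟧)
    (hS0 : S0 = Algebra.adjoin M (Set.range (PowerSeries.map (algebraMap k M))))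
    (h1 : IsAlgebraic S0 a1) (h2 : IsAlgebraic S0 a2) (hg : g ∈ S0) (hB : B ∈ S0) :
    ∀ n, coeff n B ∈ Set.range (algebraMap k M) :=
  algebraic_core_aux (FractionRing M⟦X⟧) B L1 L2 L3 a1 a2 R y g P Q c1 c2 c3 l ha1 ha2 hR hy hQ hRPQ
    hL1 hL2 hL3 hyL hB0 hBeq S0 hS0 h1 h2 hg hB

end

section

section Germs
open Filter Topology

variable {E : Type*} [NormedAddCommGroup E] [NormedSpace ℂ E]

/-- The algebra of functions analytic at `p`. -/
def An (p : E) : Subalgebra ℂ (E → ℂ) where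
  carrier := {f | AnalyticAt ℂ f p}
  mul_mem' := fun ha hb => AnalyticAt.mul ha hb
  add_mem' := fun ha hb => AnalyticAt.add ha hb
  algebraMap_mem' := fun c => (analyticAt_const : AnalyticAt ℂ (fun _ => c) p)

/-- Functions vanishing near `p`. -/
def zeroIdeal (p : E) : Ideal (An p) where
  carrier := {f | (f : E → ℂ) =ᶠ[𝓝 p] 0}
  zero_mem' := EventuallyEq.refl _ _
  add_mem' := fun {a b} ha hb => by
    have := EventuallyEq.add ha hb
    simpa using this
  smul_mem' := fun c x hx => by
    filter_upwards [hx] with y hy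
    simp only [smul_eq_mul, MulMemClass.coe_mul, Pi.mul_apply, hy, Pi.zero_apply, mul_zero]

lemma mem_zeroIdeal {p : E} {f : An p} : f ∈ zeroIdeal p ↔ (f : E → ℂ) =ᶠ[𝓝 p] 0 := Iff.rfl

lemma an_ball {p : E} {f : E → ℂ} (hf : AnalyticAt ℂ f p) :
    ∃ r > 0, AnalyticOnNhd ℂ f (Metric.ball p r) := by
  obtain ⟨r, hr, h⟩ := Metric.eventually_nhds_iff_ball.1 hf.eventually_analyticAt
  exact ⟨r, hr, h⟩

lemma an_zero_ball {p : E} {r : ℝ} {f : E → ℂ} (hf : AnalyticOnNhd ℂ f (Metric.ball p r)) {q : E}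
    (hq : q ∈ Metric.ball p r) (h : f =ᶠ[𝓝 q] 0) : Set.EqOn f 0 (Metric.ball p r) := by
  letI : NormedSpace ℝ E := NormedSpace.restrictScalars ℝ ℂ E
  exact hf.eqOn_zero_of_preconnected_of_eventuallyEq_zero (convex_ball p r).isPreconnected hq h

instance zeroIdeal_prime (p : E) : (zeroIdeal p).IsPrime := by
  refine ⟨?_, ?_⟩
  · intro h
    have h1 : (1 : An p) ∈ zeroIdeal p := h ▸ Submodule.mem_top
    have := (mem_zeroIdeal.1 h1).eq_of_nhds
    simp at this
  · intro f g hfg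
    by_contra hcon
    push Not at hcon
    obtain ⟨hf, hg⟩ := hcon
    obtain ⟨r1, hr1, h1⟩ := an_ball f.2
    obtain ⟨r2, hr2, h2⟩ := an_ball g.2
    obtain ⟨r3, hr3, h3⟩ := Metric.eventually_nhds_iff_ball.1 (mem_zeroIdeal.1 hfg)
    set r := min r1 (min r2 r3)
    have hr : 0 < r := by positivity
    have h1' := h1.mono (Metric.ball_subset_ball (min_le_left r1 (min r2 r3)))
    have h2' := h2.mono (Metric.ball_subset_ball ((min_le_right r1 (min r2 r3)).trans (min_le_left _ _)))
    have hx : ∃ x ∈ Metric.ball p r, (f : E → ℂ) x ≠ 0 := by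
      by_contra hc
      push Not at hc
      exact hf (mem_zeroIdeal.2 (Filter.eventually_of_mem (Metric.ball_mem_nhds p hr) hc))
    obtain ⟨x, hx, hfx⟩ := hx
    have hgx : (g : E → ℂ) =ᶠ[𝓝 x] 0 := by
      filter_upwards [(h1' x hx).continuousAt.eventually_ne hfx, Metric.isOpen_ball.mem_nhds hx] with y hy hy2
      have := h3 y (Metric.ball_subset_ball ((min_le_right r1 (min r2 r3)).trans (min_le_right _ _)) hy2)
      simp only [MulMemClass.coe_mul, Pi.mul_apply, Pi.zero_apply, mul_eq_zero] at this
      exact this.resolve_left hy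
    exact hg (mem_zeroIdeal.2 (Filter.eventually_of_mem (Metric.ball_mem_nhds p hr)
      (an_zero_ball h2' hx hgx)))

/-- Germs of analytic functions. -/
def Og (p : E) := An p ⧸ zeroIdeal p

noncomputable instance (p : E) : CommRing (Og p) := inferInstanceAs (CommRing (An p ⧸ zeroIdeal p))
noncomputable instance (p : E) : Algebra ℂ (Og p) := inferInstanceAs (Algebra ℂ (An p ⧸ zeroIdeal p))
instance (p : E) : IsDomain (Og p) := inferInstanceAs (IsDomain (An p ⧸ zeroIdeal p))

/-- quotient map -/
noncomputable def OgMk (p : E) : An p →ₐ[ℂ] Og p := Ideal.Quotient.mkₐ ℂ (zeroIdeal p)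

lemma OgMk_surj (p : E) : Function.Surjective (OgMk p) := Ideal.Quotient.mk_surjective

lemma OgMk_eq {p : E} (f g : An p) : OgMk p f = OgMk p g ↔ f - g ∈ zeroIdeal p :=
  Ideal.Quotient.eq

/-- germ of a function. -/
noncomputable def germ (p : E) (f : E → ℂ) (hf : AnalyticAt ℂ f p) : Og p := OgMk p ⟨f, hf⟩

lemma germ_eq {p : E} {f g : E → ℂ} {hf : AnalyticAt ℂ f p} {hg : AnalyticAt ℂ g p} :
    germ p f hf = germ p g hg ↔ f =ᶠ[𝓝 p] g := by
  rw [germ, germ, OgMk_eq, mem_zeroIdeal]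
  constructor
  · intro h
    filter_upwards [h] with x hx
    simpa [sub_eq_zero] using hx
  · intro h
    filter_upwards [h] with x hx
    simpa [sub_eq_zero] using hx

lemma germ_surj {p : E} (x : Og p) : ∃ f hf, x = germ p f hf := by
  obtain ⟨f, rfl⟩ := OgMk_surj p x
  exact ⟨f, f.2, rfl⟩

lemma germ_add {p : E} {f g : E → ℂ} (hf : AnalyticAt ℂ f p) (hg : AnalyticAt ℂ g p) :
  germ p (f + g) (hf.add hg) = germ p f hf + germ p g hg := rfl
lemma germ_mul {p : E} {f g : E → ℂ} (hf : AnalyticAt ℂ f p) (hg : AnalyticAt ℂ g p) :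
  germ p (f * g) (hf.mul hg) = germ p f hf * germ p g hg := rfl
lemma germ_const {p : E} (c : ℂ) :
  germ p (fun _ => c) analyticAt_const = algebraMap ℂ (Og p) c := rfl
lemma germ_zero {p : E} {f : E → ℂ} {hf : AnalyticAt ℂ f p} : germ p f hf = 0 ↔ f =ᶠ[𝓝 p] 0 := by
  rw [← map_zero (algebraMap ℂ (Og p)), ← germ_const, germ_eq]; rfl
lemma germ_ne_zero {p : E} {f : E → ℂ} (hf : AnalyticAt ℂ f p) (h : f p ≠ 0) : germ p f hf ≠ 0 := by
  intro h0
  have : germ p f hf = germ p (fun _ => (0:ℂ)) analyticAt_const := by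
    rw [h0, germ_const, map_zero]
  exact h (germ_eq.1 this).eq_of_nhds

/-- pullback -/
noncomputable def pull {E' : Type*} [NormedAddCommGroup E'] [NormedSpace ℂ E'] (p : E) (g : E → E')
    (hg : AnalyticAt ℂ g p) : Og (g p) →ₐ[ℂ] Og p :=
  Ideal.Quotient.liftₐ _
    ({ toFun := fun a => germ p ((a : E' → ℂ) ∘ g) (AnalyticAt.comp a.2 hg)
       map_one' := rfl
       map_mul' := fun _ _ => rfl
       map_zero' := rfl
       map_add' := fun _ _ => rfl
       commutes' := fun _ => rfl } : An (g p) →ₐ[ℂ] Og p)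
    (fun a ha => by
      have : germ p ((a : E' → ℂ) ∘ g) (AnalyticAt.comp a.2 hg) = germ p (fun _ => (0:ℂ)) analyticAt_const := by
        rw [germ_eq]
        exact hg.continuousAt.eventually (mem_zeroIdeal.1 ha)
      change germ p ((a : E' → ℂ) ∘ g) (AnalyticAt.comp a.2 hg) = 0
      rw [this, germ_const, map_zero])

lemma pull_germ {E' : Type*} [NormedAddCommGroup E'] [NormedSpace ℂ E'] (p : E) (g : E → E')
    (hg : AnalyticAt ℂ g p) (f : E' → ℂ) (hf : AnalyticAt ℂ f (g p)) :
    pull p g hg (germ (g p) f hf) = germ p (f ∘ g) (hf.comp hg) := rfl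

lemma an_fderiv {p : E} {f : E → ℂ} (hf : AnalyticAt ℂ f p) (v : E) :
    AnalyticAt ℂ (fun x => fderiv ℂ f x v) p :=
  (ContinuousLinearMap.apply ℂ ℂ v).analyticAt _ |>.comp hf.fderiv

/-- directional derivative as a linear map on germs. -/
noncomputable def dirLin (p : E) (v : E) : Og p →ₗ[ℂ] Og p :=
  Submodule.liftQ ((zeroIdeal p).restrictScalars ℂ)
    ({ toFun := fun a => germ p (fun x => fderiv ℂ (a : E → ℂ) x v) (an_fderiv a.2 v)
       map_add' := fun a b => by
         rw [← germ_add, germ_eq]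
         filter_upwards [AnalyticAt.eventually_analyticAt a.2, AnalyticAt.eventually_analyticAt b.2] with x hx hy
         change fderiv ℂ ((a : E → ℂ) + (b : E → ℂ)) x v = _
         rw [fderiv_add hx.differentiableAt hy.differentiableAt]; rfl
       map_smul' := fun c a => by
         change _ = germ p (c • fun x => fderiv ℂ (a : E → ℂ) x v) ((an_fderiv a.2 v).const_smul (c := c))
         rw [germ_eq]
         filter_upwards [AnalyticAt.eventually_analyticAt a.2] with x hx
         change fderiv ℂ (c • (a : E → ℂ)) x v = _
         rw [fderiv_const_smul hx.differentiableAt]; rfl } : An p →ₗ[ℂ] Og p)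
    (fun a ha => by
      have : germ p (fun x => fderiv ℂ (a : E → ℂ) x v) (an_fderiv a.2 v) = germ p (fun _ => (0:ℂ)) analyticAt_const := by
        rw [germ_eq]
        have h2 := EventuallyEq.fderiv (𝕜 := ℂ) (mem_zeroIdeal.1 ha)
        filter_upwards [h2] with x hx
        rw [hx]; simp
      change germ p (fun x => fderiv ℂ (a : E → ℂ) x v) (an_fderiv a.2 v) = 0
      rw [this, germ_const, map_zero])

lemma dirLin_germ (p v : E) (f : E → ℂ) (hf : AnalyticAt ℂ f p) :
    dirLin p v (germ p f hf) = germ p (fun x => fderiv ℂ f x v) (an_fderiv hf v) := rfl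

/-- directional derivation. -/
noncomputable def dirDer (p : E) (v : E) : Derivation ℂ (Og p) (Og p) :=
  Derivation.mk' (dirLin p v) (fun a b => by
    obtain ⟨f, hf, rfl⟩ := germ_surj a
    obtain ⟨g, hg, rfl⟩ := germ_surj b
    rw [← germ_mul, dirLin_germ, dirLin_germ, dirLin_germ, smul_eq_mul, smul_eq_mul, ← germ_mul, ← germ_mul,
      ← germ_add, germ_eq]
    filter_upwards [hf.eventually_analyticAt, hg.eventually_analyticAt] with x hx hy
    rw [fderiv_mul hx.differentiableAt hy.differentiableAt]; rfl)

lemma dirDer_germ (p v : E) (f : E → ℂ) (hf : AnalyticAt ℂ f p) :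
    dirDer p v (germ p f hf) = germ p (fun x => fderiv ℂ f x v) (an_fderiv hf v) := rfl

end Germs

section AbstractTaylor
open PowerSeries

variable {A B : Type*} [CommRing A] [CommRing B] [Algebra ℂ A] [Algebra ℂ B]

/-- formal Taylor series attached to a derivation and a point. -/
noncomputable def tayFun (D : Derivation ℂ A A) (ρ : A →ₐ[ℂ] B) (a : A) : B⟦X⟧ :=
  PowerSeries.mk fun n => ((n.factorial : ℂ)⁻¹) • ρ (D^[n] a)

lemma tay_deriv (D : Derivation ℂ A A) (ρ : A →ₐ[ℂ] B) (a : A) :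
    derivative B (tayFun D ρ a) = tayFun D ρ (D a) := by
  ext n
  rw [coeff_derivative, tayFun, tayFun, coeff_mk, coeff_mk, Function.iterate_succ_apply]
  rw [Algebra.smul_def, Algebra.smul_def]
  have : ((n:B)+1) = algebraMap ℂ B (n+1) := by simp
  rw [this, mul_comm, ← mul_assoc, ← map_mul]
  congr 2
  rw [Nat.factorial_succ]
  push_cast
  have : (n.factorial:ℂ) ≠ 0 := by exact_mod_cast n.factorial_ne_zero
  have h2 : (n:ℂ)+1 ≠ 0 := by exact_mod_cast n.succ_ne_zero
  field_simp

lemma tay_add (D : Derivation ℂ A A) (ρ : A →ₐ[ℂ] B) (a b : A) :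
    tayFun D ρ (a + b) = tayFun D ρ a + tayFun D ρ b := by
  ext n
  simp [tayFun, iterate_map_add]

lemma tay_mul (D : Derivation ℂ A A) (ρ : A →ₐ[ℂ] B) (a b : A) :
    tayFun D ρ (a * b) = tayFun D ρ a * tayFun D ρ b := by
  ext n
  induction n generalizing a b with
  | zero => simp [tayFun]
  | succ n ih =>
    have key : ∀ f : B⟦X⟧, coeff (n+1) f = ((n+1:ℂ)⁻¹) • coeff n (derivative B f) := by
      intro f
      rw [coeff_derivative, Algebra.smul_def]
      have : ((n:B)+1) = algebraMap ℂ B (n+1) := by simp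
      have h2 : (n:ℂ)+1 ≠ 0 := by exact_mod_cast n.succ_ne_zero
      rw [this, mul_comm, mul_assoc, ← map_mul, mul_inv_cancel₀ h2, map_one, mul_one]
    rw [key, key, tay_deriv, Derivation.leibniz, Derivation.leibniz, tay_deriv, tay_deriv, tay_add]
    simp only [smul_eq_mul, map_add, ih]

/-- formal Taylor series as an algebra hom. -/
noncomputable def tay (D : Derivation ℂ A A) (ρ : A →ₐ[ℂ] B) : A →ₐ[ℂ] B⟦X⟧ :=
  AlgHom.ofLinearMap
    { toFun := tayFun D ρ
      map_add' := tay_add D ρ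
      map_smul' := fun c a => by
        ext n
        have : ∀ a, D^[n] (c • a) = c • D^[n] a := by
          induction n with
          | zero => intro a; rfl
          | succ n ih => intro a; rw [Function.iterate_succ_apply, D.map_smul, ih]; rfl
        simp [tayFun, this, smul_comm c] }
    (by
      ext n
      rcases n with _ | n
      · simp [tayFun]
      · have : ∀ n, D^[n] 0 = 0 := fun n => iterate_map_zero D n
        simp [tayFun, coeff_one, this])
    (tay_mul D ρ)

lemma tay_apply (D : Derivation ℂ A A) (ρ : A →ₐ[ℂ] B) (a : A) : tay D ρ a = tayFun D ρ a := rfl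
end AbstractTaylor

end

section

section
open PowerSeries
variable {A B : Type*} [CommRing A] [CommRing B] [Algebra ℂ A] [Algebra ℂ B]

lemma tay_of_const (D : Derivation ℂ A A) (ρ : A →ₐ[ℂ] B) (a : A) (h : D a = 0) :
    tay D ρ a = C (ρ a) := by
  ext n
  rcases n with _ | n
  · simp [tay_apply, tayFun]
  · have : ∀ n, D^[n] 0 = 0 := fun n => iterate_map_zero D n
    simp [tay_apply, tayFun, h, this, coeff_C]

lemma tay_of_scalar (D : Derivation ℂ A A) (ρ : A →ₐ[ℂ] B) (a : A)
    (h : ∀ n, ρ (D^[n] a) ∈ Set.range (algebraMap ℂ B)) :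
    tay D ρ a ∈ Set.range (PowerSeries.map (algebraMap ℂ B)) := by
  choose c hc using h
  refine ⟨PowerSeries.mk fun n => ((n.factorial : ℂ)⁻¹) * c n, ?_⟩
  ext n
  simp only [coeff_map, coeff_mk, tay_apply, tayFun, map_mul, hc, Algebra.smul_def]

lemma tay_constCoeff (D : Derivation ℂ A A) (ρ : A →ₐ[ℂ] B) (a : A) :
    constantCoeff (tay D ρ a) = ρ a := by
  simp [tay_apply, tayFun]
end

section Tay
open Filter Topology PowerSeries

variable {E : Type*} [NormedAddCommGroup E] [NormedSpace ℂ E]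

lemma iter_an {p v : E} {f : E → ℂ} (hf : AnalyticAt ℂ f p) (n : ℕ) :
    AnalyticAt ℂ ((fun g : E → ℂ => fun x => fderiv ℂ g x v)^[n] f) p := by
  induction n generalizing f with
  | zero => exact hf
  | succ n ih => rw [Function.iterate_succ_apply]; exact ih (an_fderiv hf v)

lemma dirDer_iter {p v : E} {f : E → ℂ} (hf : AnalyticAt ℂ f p) (n : ℕ) :
    (dirDer p v)^[n] (germ p f hf) = germ p ((fun g : E → ℂ => fun x => fderiv ℂ g x v)^[n] f) (iter_an hf n) := by
  induction n generalizing f with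
  | zero => rfl
  | succ n ih =>
    rw [Function.iterate_succ_apply, dirDer_germ, ih]; rfl

lemma emb_an (p : E) (t0 : ℂ) : AnalyticAt ℂ (fun q : E => (q, t0)) p :=
  analyticAt_id.prod analyticAt_const

/-- restriction to the slice `t = t0`. -/
noncomputable def restr (p : E) (t0 : ℂ) : Og (p, t0) →ₐ[ℂ] Og p :=
  pull p (fun q : E => (q, t0)) (emb_an p t0)

/-- Taylor expansion in the last variable. -/
noncomputable def Tay (p : E) (t0 : ℂ) : Og (p, t0) →ₐ[ℂ] (Og p)⟦X⟧ :=
  tay (dirDer (p, t0) (0, 1)) (restr p t0)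

lemma Tay_deriv (p : E) (t0 : ℂ) (a : Og (p, t0)) :
    Tay p t0 (dirDer (p, t0) (0, 1) a) = derivative _ (Tay p t0 a) :=
  (tay_deriv (dirDer (p, t0) (0, 1)) (restr p t0) a).symm

lemma Tay_constCoeff (p : E) (t0 : ℂ) (f : E × ℂ → ℂ) (hf : AnalyticAt ℂ f (p, t0)) :
    constantCoeff (Tay p t0 (germ (p, t0) f hf)) =
      germ p (fun q => f (q, t0)) (AnalyticAt.comp (x := p) hf (emb_an p t0)) :=
  tay_constCoeff _ _ _

lemma Tay_fst (p : E) (t0 : ℂ) (f : E → ℂ) (hf : AnalyticAt ℂ f p) (hf' : AnalyticAt ℂ (fun x : E × ℂ => f x.1) (p, t0)) :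
    Tay p t0 (germ (p, t0) (fun x => f x.1) hf') = C (germ p f hf) := by
  rw [Tay, tay_of_const]
  · rfl
  · rw [dirDer_germ, germ_zero]
    have h1 : ∀ᶠ x : E × ℂ in 𝓝 (p, t0), AnalyticAt ℂ f x.1 :=
      (continuousAt_fst (p := ((p,t0) : E × ℂ))).eventually hf.eventually_analyticAt
    filter_upwards [h1] with x hx
    have := (hx.differentiableAt.hasFDerivAt.comp x hasFDerivAt_fst).fderiv
    change fderiv ℂ (f ∘ Prod.fst) x (0,1) = 0
    rw [this]; simp

lemma Tay_snd (p : E) (t0 : ℂ) (f : ℂ → ℂ) (hf : AnalyticAt ℂ f t0) (hf' : AnalyticAt ℂ (fun x : E × ℂ => f x.2) (p, t0)) :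
    Tay p t0 (germ (p, t0) (fun x => f x.2) hf') ∈ Set.range (PowerSeries.map (algebraMap ℂ (Og p))) := by
  refine tay_of_scalar _ _ _ fun n => ?_
  have : ∀ (n : ℕ) (f : ℂ → ℂ) (hf : AnalyticAt ℂ f t0) (hf' : AnalyticAt ℂ (fun x : E × ℂ => f x.2) (p, t0)),
    ∃ g : ℂ → ℂ, ∃ hg : AnalyticAt ℂ (fun x : E × ℂ => g x.2) (p, t0),
      (dirDer (p, t0) (0, 1))^[n] (germ (p, t0) (fun x => f x.2) hf') = germ (p, t0) (fun x => g x.2) hg := by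
    intro n
    induction n with
    | zero => intro f hf hf'; exact ⟨f, hf', rfl⟩
    | succ n ih =>
      intro f hf hf'
      have hd : AnalyticAt ℂ (deriv f) t0 := hf.deriv
      have hd' : AnalyticAt ℂ (fun x : E × ℂ => deriv f x.2) (p, t0) :=
        AnalyticAt.comp (x := (p,t0)) (f := Prod.snd) (g := deriv f) hd analyticAt_snd
      obtain ⟨g, hg, h⟩ := ih (deriv f) hd hd'
      refine ⟨g, hg, ?_⟩
      rw [Function.iterate_succ_apply, ← h]
      congr 1
      rw [dirDer_germ, germ_eq]
      have h1 : ∀ᶠ x : E × ℂ in 𝓝 (p, t0), AnalyticAt ℂ f x.2 :=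
        (continuousAt_snd (p := ((p,t0) : E × ℂ))).eventually hf.eventually_analyticAt
      filter_upwards [h1] with x hx
      have := (hx.differentiableAt.hasFDerivAt.comp x hasFDerivAt_snd).fderiv
      change fderiv ℂ (f ∘ Prod.snd) x (0,1) = _
      rw [this]; simp
  obtain ⟨g, hg, h⟩ := this n f hf hf'
  exact ⟨g t0, by rw [h]; rfl⟩

lemma slice_iter {f : E × ℂ → ℂ} {S : Set (E × ℂ)} (hS : IsOpen S) (hf : AnalyticOnNhd ℂ f S) (n : ℕ)
    (q : E) (t : ℂ) (hqt : (q, t) ∈ S) :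
    iteratedDeriv n (fun t => f (q, t)) t = ((fun g : E × ℂ → ℂ => fun x => fderiv ℂ g x (0, 1))^[n] f) (q, t) := by
  induction n generalizing f t with
  | zero => rfl
  | succ n ih =>
    rw [iteratedDeriv_succ', Function.iterate_succ_apply, ← ih (f := fun x => fderiv ℂ f x (0,1)) (fun x hx => an_fderiv (hf x hx) _) t hqt]
    apply Filter.EventuallyEq.iteratedDeriv_eq
    have h1 : ∀ᶠ t' in 𝓝 t, (q, t') ∈ S :=
      (Continuous.prodMk_right q).continuousAt.eventually (hS.mem_nhds hqt)
    filter_upwards [h1] with t' ht'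
    have h2 : HasDerivAt (fun t' : ℂ => (q, t')) ((0 : E), (1 : ℂ)) t' :=
      (hasDerivAt_const t' q).prodMk (hasDerivAt_id t')
    exact ((hf _ ht').differentiableAt.hasFDerivAt.comp_hasDerivAt t' h2).deriv

lemma an_zero_of_iter {f : ℂ → ℂ} {t : ℂ} (hf : AnalyticAt ℂ f t) (h : ∀ n, iteratedDeriv n f t = 0) :
    f =ᶠ[𝓝 t] 0 := by
  have := hf.hasFPowerSeriesAt
  have h0 : (FormalMultilinearSeries.ofScalars ℂ fun n => iteratedDeriv n f t / n.factorial) = 0 := by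
    ext n
    simp [FormalMultilinearSeries.ofScalars, h]
  rw [h0] at this
  exact this.eventually_eq_zero

lemma Tay_inj (p : E) (t0 : ℂ) : Function.Injective (Tay p t0) := by
  rw [injective_iff_map_eq_zero]
  intro a ha
  obtain ⟨f, hf, rfl⟩ := germ_surj a
  obtain ⟨r, hr, han⟩ := an_ball hf
  rw [← ball_prod_same] at han
  have h1 : ∀ n, ∀ q ∈ Metric.ball p r, ((fun g : E × ℂ → ℂ => fun x => fderiv ℂ g x (0, 1))^[n] f) (q, t0) = 0 := by
    intro n
    have h2 : coeff n (Tay p t0 (germ (p,t0) f hf)) = 0 := by rw [ha]; simp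
    rw [Tay, tay_apply, tayFun, coeff_mk, smul_eq_zero, dirDer_iter] at h2
    have h3 := h2.resolve_left (inv_ne_zero (by exact_mod_cast n.factorial_ne_zero))
    have h4 : germ p (fun q => ((fun g : E × ℂ → ℂ => fun x => fderiv ℂ g x (0, 1))^[n] f) (q, t0))
      (AnalyticAt.comp (x := p) (iter_an hf n) (emb_an p t0)) = germ p (fun _ => (0:ℂ)) analyticAt_const := by
      rw [germ_const, map_zero]; exact h3
    rw [germ_eq] at h4
    refine an_zero_ball ?_ (Metric.mem_ball_self hr) h4
    intro q hq
    exact AnalyticAt.comp (x := q) (iter_an (han (q,t0) ⟨hq, Metric.mem_ball_self hr⟩) n) (emb_an q t0)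
  rw [germ_zero]
  refine Filter.eventually_of_mem (Metric.ball_mem_nhds (p,t0) hr) ?_
  rintro ⟨q, t⟩ hqt
  rw [← ball_prod_same] at hqt
  have h5 : ∀ t ∈ Metric.ball t0 r, AnalyticAt ℂ (fun t => f (q, t)) t := fun t ht =>
    AnalyticAt.comp (x := t) (han (q,t) ⟨hqt.1, ht⟩) (analyticAt_const.prod analyticAt_id)
  have := an_zero_ball (p := t0) (r := r) (f := fun t => f (q, t)) h5 (Metric.mem_ball_self hr)
    (an_zero_of_iter (h5 t0 (Metric.mem_ball_self hr)) (fun n => by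
      rw [slice_iter (Metric.isOpen_ball.prod Metric.isOpen_ball) han n q t0 ⟨hqt.1, Metric.mem_ball_self hr⟩]
      exact h1 n q hqt.1))
  exact this hqt.2
end Tay

end

section

section
open PowerSeries

lemma nash_alg {σ S T : Type*} [Finite σ] [CommRing T] [IsDomain T] [CommRing S] [Algebra ℂ S] [Algebra ℂ T]
    [Algebra S T] [IsScalarTower ℂ S T] (hinj : Function.Injective (algebraMap S T))
    (g : σ → S) (P : Polynomial (MvPolynomial σ ℂ)) (hP : P ≠ 0) :
    ∃ v : σ → ℂ, ∀ Ψ : T⟦X⟧,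
      Polynomial.eval₂ (MvPolynomial.aeval (R := ℂ) (S₁ := T⟦X⟧)
        (fun i => C (algebraMap S T (g i)) + algebraMap ℂ T⟦X⟧ (v i) * X)).toRingHom Ψ P = 0 →
      IsAlgebraic S (constantCoeff Ψ) := by
  have : IsDomain S := hinj.isDomain (algebraMap S T)
  obtain ⟨k, hk⟩ : ∃ k, P.coeff k ≠ 0 := by
    by_contra h
    push Not at h
    exact hP (Polynomial.ext (by simpa using h))
  have hinjC : Function.Injective (algebraMap ℂ S) := (algebraMap ℂ S).injective
  obtain ⟨v, hv⟩ : ∃ v : σ → ℂ, MvPolynomial.aeval (fun i => g i + algebraMap ℂ S (v i)) (P.coeff k) ≠ 0 := by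
    by_contra hcon
    push Not at hcon
    have hz : MvPolynomial.map (algebraMap ℂ S) (P.coeff k) = 0 := by
      refine MvPolynomial.funext_set (fun i => Set.range (fun z : ℂ => g i + algebraMap ℂ S z)) ?_ ?_
      · intro i
        exact Set.infinite_range_of_injective fun a b hab => hinjC (add_left_cancel hab)
      · intro x hx
        choose z hz using fun i => hx i (Set.mem_univ i)
        have : x = fun i => g i + algebraMap ℂ S (z i) := by ext i; exact (hz i).symm
        rw [map_zero, this, MvPolynomial.eval_map, ← MvPolynomial.aeval_def, hcon]
    exact hk ((MvPolynomial.map_injective _ hinjC) (by rw [hz, map_zero]))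
  refine ⟨v, fun Ψ hΨ => ?_⟩
  let κ0 : MvPolynomial σ ℂ →ₐ[ℂ] Polynomial (Polynomial S) :=
    MvPolynomial.aeval (fun i => Polynomial.C (Polynomial.C (g i)) + algebraMap ℂ _ (v i) * Polynomial.X)
  let Q := Polynomial.eval₂ κ0.toRingHom (Polynomial.C Polynomial.X) P
  have hQ : Q ≠ 0 := by
    intro h0
    have h1 : Polynomial.eval 1 Q = P.map (MvPolynomial.aeval (fun i => g i + algebraMap ℂ S (v i))).toRingHom := by
      rw [← Polynomial.coe_evalRingHom, Polynomial.hom_eval₂, Polynomial.map]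
      have : (Polynomial.evalRingHom (1 : Polynomial S)).comp κ0.toRingHom =
        Polynomial.C.comp (MvPolynomial.aeval (fun i => g i + algebraMap ℂ S (v i))).toRingHom := by
        ext i
        · simp [κ0]
        · simp [κ0]
      rw [this]; simp
    rw [h0] at h1
    have h2 := congrArg (fun p => Polynomial.coeff p k) h1
    simp at h2
    exact hv h2.symm
  obtain ⟨q, hq, hnd⟩ := Polynomial.exists_eq_pow_rootMultiplicity_mul_and_not_dvd Q hQ 0
  rw [map_zero, sub_zero] at hq hnd
  rw [Polynomial.X_dvd_iff] at hnd
  let Θ0 : Polynomial S →+* T⟦X⟧ := Polynomial.eval₂RingHom ((C : T →+* T⟦X⟧).comp (algebraMap S T)) Ψ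
  let Θ : Polynomial (Polynomial S) →+* T⟦X⟧ := Polynomial.eval₂RingHom Θ0 X
  have hΘQ : Θ Q = 0 := by
    rw [Polynomial.hom_eval₂]
    have e1 : Θ (Polynomial.C Polynomial.X) = Ψ := by simp [Θ, Θ0]
    rw [e1, ← hΨ]
    congr 1
    refine MvPolynomial.ringHom_ext (fun c => ?_) (fun i => ?_)
    · simp [Θ, Θ0, κ0, PowerSeries.algebraMap_apply, ← IsScalarTower.algebraMap_apply]
    · have hA : algebraMap ℂ (Polynomial (Polynomial S)) (v i) = Polynomial.C (Polynomial.C (algebraMap ℂ S (v i))) := rfl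
      simp [Θ, Θ0, κ0, PowerSeries.algebraMap_apply, hA, ← IsScalarTower.algebraMap_apply]
  rw [hq, map_mul, map_pow] at hΘQ
  have hX : Θ Polynomial.X = X := by simp [Θ]
  rw [hX] at hΘQ
  have h3 : Θ q = 0 := (mul_eq_zero.1 hΘQ).resolve_left (pow_ne_zero _ PowerSeries.X_ne_zero)
  refine ⟨q.coeff 0, hnd, ?_⟩
  have h4 := congrArg (constantCoeff (R := T)) h3
  have h5 : constantCoeff.comp Θ = (Polynomial.aeval (R := S) (constantCoeff Ψ)).toRingHom.comp Polynomial.constantCoeff := by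
    ext i
    · simp [Θ, Θ0]
    · simp [Θ, Θ0]
    · simp [Θ, Θ0]
  have h6 := RingHom.congr_fun h5 q
  simp at h6
  rw [map_zero] at h4
  rw [← h4]; exact h6.symm
end

end

section

section

lemma deriv_alg_gen {R T : Type*} [CommRing R] [IsDomain R] [CommRing T] [IsDomain T] [CharZero T] [Algebra R T] [Algebra ℂ T]
    (hinj : Function.Injective (algebraMap R T)) (D : Derivation ℂ T T)
    (hD : ∀ r : R, ∃ r' : R, D (algebraMap R T r) = algebraMap R T r') (a : T) (ha : IsAlgebraic R a) :
    IsAlgebraic R (D a) := by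
  have : CharZero R := ⟨fun a b hab => by
    have := congrArg (algebraMap R T) hab
    simpa using this⟩
  have key : ∀ p : Polynomial R, ∃ q : Polynomial R, D (Polynomial.aeval a p) =
      Polynomial.aeval a q + Polynomial.aeval a (Polynomial.derivative p) * D a := by
    intro p
    induction p using Polynomial.induction_on' with
    | add p q hp hq =>
      obtain ⟨p', hp⟩ := hp
      obtain ⟨q', hq⟩ := hq
      exact ⟨p' + q', by simp only [map_add, hp, hq]; ring⟩
    | monomial n b =>
      obtain ⟨b', hb'⟩ := hD b
      refine ⟨Polynomial.monomial n b', ?_⟩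
      simp only [Polynomial.aeval_monomial, Polynomial.derivative_monomial, Derivation.leibniz,
        Derivation.leibniz_pow]
      simp only [map_mul, map_natCast, smul_eq_mul, nsmul_eq_mul, hb']
      ring
  have hA : ∀ p : Polynomial R, IsAlgebraic R (Polynomial.aeval a p) := by
    intro p
    induction p using Polynomial.induction_on' with
    | add p q hp hq => rw [map_add]; exact hp.add hq
    | monomial n b => rw [Polynomial.aeval_monomial]; exact (isAlgebraic_algebraMap b).mul (ha.pow n)
  have hex : ∃ n : ℕ, ∃ p : Polynomial R, p.natDegree = n ∧ p ≠ 0 ∧ Polynomial.aeval a p = 0 := by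
    obtain ⟨p, h1, h2⟩ := ha
    exact ⟨_, p, rfl, h1, h2⟩
  classical
  obtain ⟨p, hpn, hp0, hpa⟩ := Nat.find_spec hex
  have hmin := fun m (hm : m < Nat.find hex) => Nat.find_min hex hm
  have hdeg : p.natDegree ≠ 0 := by
    intro h0
    rw [Polynomial.eq_C_of_natDegree_eq_zero h0, Polynomial.aeval_C] at hpa
    have := hinj (hpa.trans (map_zero _).symm)
    exact hp0 (by rw [Polynomial.eq_C_of_natDegree_eq_zero h0, this, map_zero])
  have hd : Polynomial.derivative p ≠ 0 := fun h => hdeg (Polynomial.natDegree_eq_zero_of_derivative_eq_zero h)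
  have hne : Polynomial.aeval a (Polynomial.derivative p) ≠ 0 := by
    intro h
    refine hmin (Polynomial.derivative p).natDegree ?_ ⟨_, rfl, hd, h⟩
    rw [← hpn]
    exact Polynomial.natDegree_derivative_lt hdeg
  obtain ⟨q, hq⟩ := key p
  rw [hpa, map_zero] at hq
  refine IsAlgebraic.of_mul (mem_nonZeroDivisors_of_ne_zero hne) (hA _) ?_
  have : Polynomial.aeval a (Polynomial.derivative p) * D a = - Polynomial.aeval a q := by
    linear_combination -hq
  rw [this]
  exact (hA q).neg

open Filter Topology

instance {E : Type*} [NormedAddCommGroup E] [NormedSpace ℂ E] (p : E) : CharZero (Og p) :=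
  charZero_of_injective_algebraMap (algebraMap ℂ (Og p)).injective

abbrev Em (m : ℕ) := (Fin m → ℂ) × (Fin m → ℂ)

lemma coord_an {m : ℕ} (p : Em m) (i : Fin m ⊕ Fin m) :
    AnalyticAt ℂ (fun p : Em m => Sum.elim p.1 p.2 i) p := by
  rcases i with i | i
  · exact ((ContinuousLinearMap.proj i).comp (ContinuousLinearMap.fst ℂ (Fin m → ℂ) (Fin m → ℂ)) : Em m →L[ℂ] ℂ).analyticAt p
  · exact ((ContinuousLinearMap.proj i).comp (ContinuousLinearMap.snd ℂ (Fin m → ℂ) (Fin m → ℂ)) : Em m →L[ℂ] ℂ).analyticAt p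

noncomputable instance polAlg {m : ℕ} (p : Em m) : Algebra (MvPolynomial (Fin m ⊕ Fin m) ℂ) (Og p) :=
  (MvPolynomial.aeval (R := ℂ) (fun i => germ p _ (coord_an p i))).toRingHom.toAlgebra

lemma polAlg_eq {m : ℕ} (p : Em m) (P : MvPolynomial (Fin m ⊕ Fin m) ℂ) :
    algebraMap _ (Og p) P = MvPolynomial.aeval (R := ℂ) (fun i => germ p _ (coord_an p i)) P := rfl

lemma polAlg_germ {m : ℕ} (p : Em m) (P : MvPolynomial (Fin m ⊕ Fin m) ℂ) :
    ∃ h, algebraMap _ (Og p) P = germ p (fun x => MvPolynomial.eval (Sum.elim x.1 x.2) P) h := by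
  induction P using MvPolynomial.induction_on with
  | C a => exact ⟨by simpa using analyticAt_const, by simp [polAlg_eq, ← germ_const]⟩
  | add P Q hP hQ =>
    obtain ⟨h1, h1'⟩ := hP
    obtain ⟨h2, h2'⟩ := hQ
    have h := h1.add h2
    refine ⟨by simp only [map_add]; exact h, ?_⟩
    rw [map_add, h1', h2', ← germ_add, germ_eq]
    exact Eventually.of_forall fun x => by simp
  | mul_X P i hP =>
    obtain ⟨h1, h1'⟩ := hP
    have h := h1.mul (coord_an p i)
    refine ⟨by simp only [map_mul, MvPolynomial.eval_X]; exact h, ?_⟩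
    rw [map_mul, h1', polAlg_eq p (MvPolynomial.X i), MvPolynomial.aeval_X, ← germ_mul, germ_eq]
    exact Eventually.of_forall fun x => by simp

lemma polAlg_inj {m : ℕ} (p : Em m) :
    Function.Injective (algebraMap (MvPolynomial (Fin m ⊕ Fin m) ℂ) (Og p)) := by
  rw [injective_iff_map_eq_zero]
  intro P hP
  obtain ⟨h1, h2⟩ := polAlg_germ p P
  rw [hP] at h2
  have h3 := germ_zero.1 h2.symm
  obtain ⟨r, hr, h⟩ := Metric.eventually_nhds_iff_ball.1 h3
  refine MvPolynomial.funext_set (fun i => Metric.ball (Sum.elim p.1 p.2 i) r) (fun i => ?_) ?_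
  · exact infinite_of_mem_nhds _ (Metric.ball_mem_nhds _ hr)
  · intro x hx
    rw [map_zero]
    have := h (fun i => x (Sum.inl i), fun i => x (Sum.inr i)) ?_
    · have e : Sum.elim (fun i => x (Sum.inl i)) (fun i => x (Sum.inr i)) = x := by
        ext i; rcases i with i | i <;> rfl
      simpa [e] using this
    · rw [← ball_prod_same]
      refine ⟨?_, ?_⟩
      · rw [ball_pi _ hr]
        exact fun i _ => hx (Sum.inl i) (Set.mem_univ _)
      · rw [ball_pi _ hr]
        exact fun i _ => hx (Sum.inr i) (Set.mem_univ _)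

lemma polAlg_deriv {m : ℕ} (p v : Em m) (P : MvPolynomial (Fin m ⊕ Fin m) ℂ) :
    ∃ Q, dirDer p v (algebraMap _ (Og p) P) = algebraMap (MvPolynomial (Fin m ⊕ Fin m) ℂ) (Og p) Q := by
  induction P using MvPolynomial.induction_on with
  | C a => exact ⟨0, by rw [polAlg_eq, MvPolynomial.aeval_C, Derivation.map_algebraMap, map_zero]⟩
  | add P Q hP hQ =>
    obtain ⟨P', hP⟩ := hP
    obtain ⟨Q', hQ⟩ := hQ
    exact ⟨P' + Q', by simp only [map_add, hP, hQ]⟩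
  | mul_X P i hP =>
    obtain ⟨P', hP⟩ := hP
    have hX : dirDer p v (algebraMap (MvPolynomial (Fin m ⊕ Fin m) ℂ) (Og p) (MvPolynomial.X i)) =
        algebraMap (MvPolynomial (Fin m ⊕ Fin m) ℂ) (Og p) (MvPolynomial.C (Sum.elim v.1 v.2 i)) := by
      rw [polAlg_eq, polAlg_eq, MvPolynomial.aeval_X, MvPolynomial.aeval_C, dirDer_germ, ← germ_const, germ_eq]
      refine Eventually.of_forall fun x => ?_
      rcases i with i | i
      · exact congrArg (fun L : Em m →L[ℂ] ℂ => L v)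
          ((ContinuousLinearMap.proj i).comp (ContinuousLinearMap.fst ℂ (Fin m → ℂ) (Fin m → ℂ)) : Em m →L[ℂ] ℂ).fderiv
      · exact congrArg (fun L : Em m →L[ℂ] ℂ => L v)
          ((ContinuousLinearMap.proj i).comp (ContinuousLinearMap.snd ℂ (Fin m → ℂ) (Fin m → ℂ)) : Em m →L[ℂ] ℂ).fderiv
    refine ⟨P * MvPolynomial.C (Sum.elim v.1 v.2 i) + MvPolynomial.X i * P', ?_⟩
    rw [map_mul, Derivation.leibniz, hX, hP, smul_eq_mul, smul_eq_mul, map_add, map_mul, map_mul]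

lemma nash_deriv {m : ℕ} (p v : Em m) (f : Em m → ℂ) (hf : AnalyticAt ℂ f p)
    (h : IsAlgebraic (MvPolynomial (Fin m ⊕ Fin m) ℂ) (germ p f hf)) :
    IsAlgebraic (MvPolynomial (Fin m ⊕ Fin m) ℂ) (germ p (fun x => fderiv ℂ f x v) (an_fderiv hf v)) :=
  deriv_alg_gen (polAlg_inj p) (dirDer p v) (polAlg_deriv p v) _ h

lemma nash_germ {m : ℕ} {f : Em m → ℂ} {p : Em m} (hf : AnalyticAt ℂ f p)
    (U : Set (Em m)) (hU : U ∈ 𝓝 p) (P : MvPolynomial (Option (Fin m ⊕ Fin m)) ℂ) (hP : P ≠ 0)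
    (h : ∀ p ∈ U, MvPolynomial.eval (fun o => o.elim (f p) (Sum.elim p.1 p.2)) P = 0) :
    IsAlgebraic (MvPolynomial (Fin m ⊕ Fin m) ℂ) (germ p f hf) := by
  refine ⟨MvPolynomial.optionEquivLeft ℂ _ P, by simpa using hP, ?_⟩
  have key : ∀ Q : Polynomial (MvPolynomial (Fin m ⊕ Fin m) ℂ), ∃ h,
      Polynomial.aeval (germ p f hf) Q = germ p (fun x => Polynomial.eval (f x)
        (Polynomial.map (MvPolynomial.eval (Sum.elim x.1 x.2)) Q)) h := by
    intro Q
    induction Q using Polynomial.induction_on' with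
    | add P Q hP hQ =>
      obtain ⟨h1, h1'⟩ := hP
      obtain ⟨h2, h2'⟩ := hQ
      have h := h1.add h2
      refine ⟨by simp only [Polynomial.map_add, Polynomial.eval_add]; exact h, ?_⟩
      rw [map_add, h1', h2', ← germ_add, germ_eq]
      exact Eventually.of_forall fun x => by simp
    | monomial n b =>
      obtain ⟨h1, h1'⟩ := polAlg_germ p b
      refine ⟨by simp only [Polynomial.map_monomial, Polynomial.eval_monomial]; exact h1.mul (hf.pow n), ?_⟩
      have : germ p f hf ^ n = germ p (f ^ n) (hf.pow n) := rfl
      rw [Polynomial.aeval_monomial, h1', this, ← germ_mul, germ_eq]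
      exact Eventually.of_forall fun x => by simp
  obtain ⟨h1, h2⟩ := key (MvPolynomial.optionEquivLeft ℂ _ P)
  rw [h2, germ_zero]
  filter_upwards [hU] with x hx
  rw [← MvPolynomial.optionEquivLeft_elim_eval]
  exact h x hx
end

end

section

section
open Filter Topology PowerSeries

/-- pullback with prescribed image point. -/
noncomputable def pullAt {E E' : Type*} [NormedAddCommGroup E] [NormedSpace ℂ E] [NormedAddCommGroup E'] [NormedSpace ℂ E']
    (p : E) (p' : E') (g : E → E') (hg : AnalyticAt ℂ g p) (h : g p = p') : Og p' →ₐ[ℂ] Og p := by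
  subst h
  exact pull p g hg

lemma pullAt_germ {E E' : Type*} [NormedAddCommGroup E] [NormedSpace ℂ E] [NormedAddCommGroup E'] [NormedSpace ℂ E']
    (p : E) (p' : E') (g : E → E') (hg : AnalyticAt ℂ g p) (h : g p = p') (f : E' → ℂ) (hf : AnalyticAt ℂ f p') :
    pullAt p p' g hg h (germ p' f hf) = germ p (f ∘ g) (AnalyticAt.comp (h ▸ hf) hg) := by
  subst h
  rfl

lemma Tay_X {E : Type*} [NormedAddCommGroup E] [NormedSpace ℂ E] (p : E)
    (h : AnalyticAt ℂ (fun x : E × ℂ => x.2) (p, 0)) : Tay p 0 (germ (p, 0) (fun x => x.2) h) = X := by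
  have hD : dirDer (p, (0:ℂ)) (0, 1) (germ (p, 0) (fun x => x.2) h) = 1 := by
    rw [dirDer_germ, ← map_one (algebraMap ℂ (Og (p, (0:ℂ)))), ← germ_const, germ_eq]
    refine Eventually.of_forall fun x => ?_
    change fderiv ℂ Prod.snd x (0,1) = 1
    rw [fderiv_snd]; rfl
  ext n
  rw [Tay, tay_apply, tayFun, coeff_mk]
  rcases n with _ | _ | n
  · have : restr p 0 (germ (p, 0) (fun x => x.2) h) = 0 := by
      rw [restr, pull_germ, germ_zero]; exact Eventually.of_forall fun x => rfl
    simp [this]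
  · simp [hD]
  · have h0 : ∀ n, (dirDer (p, (0:ℂ)) (0, 1))^[n] 0 = 0 := fun n => iterate_map_zero _ n
    rw [Function.iterate_succ_apply, hD, Function.iterate_succ_apply, Derivation.map_one_eq_zero, h0]
    simp [coeff_X]

lemma nash_sub {m : ℕ} {E S T : Type*} [NormedAddCommGroup E] [NormedSpace ℂ E] [CommRing T] [IsDomain T] [CommRing S] [Algebra ℂ S] [Algebra ℂ T]
    [Algebra S T] [IsScalarTower ℂ S T] (hinj : Function.Injective (algebraMap S T))
    (e0 : E) (p0 : Em m) (G : E → Em m) (hG : AnalyticAt ℂ G e0) (h0 : G e0 = p0)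
    (θ : Og e0 →ₐ[ℂ] T)
    (hS : ∀ i, θ (germ e0 (fun x => Sum.elim (G x).1 (G x).2 i)
      (AnalyticAt.comp (coord_an (G e0) i) hG)) ∈ Set.range (algebraMap S T))
    (f : Em m → ℂ) (hf : AnalyticAt ℂ f p0)
    (halg : IsAlgebraic (MvPolynomial (Fin m ⊕ Fin m) ℂ) (germ p0 f hf)) :
    IsAlgebraic S (θ (germ e0 (f ∘ G) (AnalyticAt.comp (h0 ▸ hf) hG))) := by
  obtain ⟨P, hP, hPa⟩ := halg
  choose g hg using hS
  obtain ⟨v, hv⟩ := nash_alg hinj g P hP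
  let w : Em m := (fun i => v (Sum.inl i), fun i => v (Sum.inr i))
  let hh : E × ℂ → Em m := fun x => G x.1 + x.2 • w
  have hGf : AnalyticAt ℂ (fun x : E × ℂ => G x.1) (e0, (0:ℂ)) :=
    AnalyticAt.comp (x := (e0, (0:ℂ))) (f := Prod.fst) (g := G) hG analyticAt_fst
  have hhan : AnalyticAt ℂ hh (e0, (0:ℂ)) := hGf.add (analyticAt_snd.smul analyticAt_const)
  have hh0 : hh (e0, (0:ℂ)) = p0 := by simp [hh, h0]
  let χ : Og p0 →ₐ[ℂ] T⟦X⟧ := (PowerSeries.mapAlgHom θ).comp ((Tay e0 0).comp (pullAt (e0, (0:ℂ)) p0 hh hhan hh0))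
  have hχX : ∀ i, χ (germ p0 _ (coord_an p0 i)) = C (algebraMap S T (g i)) + algebraMap ℂ T⟦X⟧ (v i) * X := by
    intro i
    have hsnd : AnalyticAt ℂ (fun x : E × ℂ => x.2) (e0, (0:ℂ)) := analyticAt_snd
    have hco : AnalyticAt ℂ (fun x => Sum.elim (G x).1 (G x).2 i) e0 := AnalyticAt.comp (coord_an (G e0) i) hG
    have hco' : AnalyticAt ℂ (fun x : E × ℂ => Sum.elim (G x.1).1 (G x.1).2 i) (e0, (0:ℂ)) :=
      AnalyticAt.comp (x := (e0, (0:ℂ))) (f := Prod.fst) (g := fun x => Sum.elim (G x).1 (G x).2 i) hco analyticAt_fst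
    have e1 : pullAt (e0, (0:ℂ)) p0 hh hhan hh0 (germ p0 _ (coord_an p0 i)) =
        germ (e0, (0:ℂ)) (fun x : E × ℂ => Sum.elim (G x.1).1 (G x.1).2 i) hco' +
          algebraMap ℂ _ (v i) * germ (e0, (0:ℂ)) (fun x => x.2) hsnd := by
      rw [pullAt_germ, ← germ_const, ← germ_mul, ← germ_add, germ_eq]
      refine Eventually.of_forall fun x => ?_
      rcases i with i | i
      · simp [hh, w, mul_comm]
      · simp [hh, w, mul_comm]
    simp only [χ, AlgHom.comp_apply, e1, map_add, map_mul, AlgHom.commutes, Tay_X]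
    rw [Tay_fst e0 0 _ hco, hg]
    change PowerSeries.map (θ : Og e0 →+* T) (C _) + _ * PowerSeries.map (θ : Og e0 →+* T) X = _
    rw [map_C, map_X]; rfl
  have hev : Polynomial.eval₂ (MvPolynomial.aeval (R := ℂ) (S₁ := T⟦X⟧)
        (fun i => C (algebraMap S T (g i)) + algebraMap ℂ T⟦X⟧ (v i) * X)).toRingHom (χ (germ p0 f hf)) P = 0 := by
    rw [← map_zero χ.toRingHom, ← hPa, Polynomial.aeval_def, Polynomial.hom_eval₂]
    congr 1
    refine MvPolynomial.ringHom_ext (fun c => ?_) (fun i => ?_)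
    · simp [polAlg_eq]
    · simp [polAlg_eq, ← hχX]
  have := hv _ hev
  convert this using 1
  simp only [χ, AlgHom.comp_apply, pullAt_germ]
  rw [← coeff_zero_eq_constantCoeff_apply]
  change _ = coeff 0 (PowerSeries.map _ _)
  rw [coeff_map, coeff_zero_eq_constantCoeff_apply, Tay_constCoeff]
  change θ _ = θ _
  congr 1
  rw [germ_eq]
  exact Eventually.of_forall fun x => by simp [hh]
end

end

section

section
open Filter Topology MeasureTheory Complex Set Metric
open scoped Real

lemma torusMap_dist {n : ℕ} (c : Fin n → ℂ) {r : ℝ} (hr : 0 < r) (θ : Fin n → ℝ) (i : Fin n) :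
    dist (torusMap c (fun _ => r) θ i) (c i) = r := by
  simp [torusMap, dist_eq_norm, norm_exp_ofReal_mul_I, hr.le]

lemma torusMap_cont {n : ℕ} (c : Fin n → ℂ) (r : Fin n → ℝ) : Continuous (torusMap c r) := by
  unfold torusMap; fun_prop

lemma osg_ne {w c ζ : ℂ} {r : ℝ} (hw : dist w c < r) (h : dist ζ c = r) : ζ - w ≠ 0 := by
  intro h0
  rw [sub_eq_zero.1 h0] at h
  linarith

lemma osg_cauchy : ∀ (n : ℕ) (c w : Fin n → ℂ) (r : ℝ) (hr : 0 < r) (W : Set (Fin n → ℂ)) (hWo : IsOpen W)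
    (hW : ∀ z : Fin n → ℂ, (∀ i, dist (z i) (c i) ≤ r) → z ∈ W)
    (hw : ∀ i, dist (w i) (c i) < r) (f : (Fin n → ℂ) → ℂ) (hf : DifferentiableOn ℂ f W),
    (∯ ζ in T(c, fun _ => r), (∏ i, (ζ i - w i)⁻¹) * f ζ) = (2 * π * I) ^ n * f w := by
  intro n
  induction n with
  | zero =>
    intro c w r hr W hWo hW hw f hf
    rw [torusIntegral_dim0]
    simp [Subsingleton.elim c w]
  | succ n ih =>
    intro c w r hr W hWo hW hw f hf
    have hTor : TorusIntegrable (fun ζ => (∏ i, (ζ i - w i)⁻¹) * f ζ) c (fun _ => r) := by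
      unfold TorusIntegrable
      apply Continuous.integrableOn_Icc
      apply Continuous.mul
      · refine continuous_finsetProd _ fun i _ => Continuous.inv₀ ?_ ?_
        · have := (continuous_apply i).comp (torusMap_cont c (fun _ => r))
          exact this.sub continuous_const
        · intro θ; exact osg_ne (hw i) (torusMap_dist c hr θ i)
      · exact hf.continuousOn.comp_continuous (torusMap_cont c _) fun θ => hW _ fun i => (torusMap_dist c hr θ i).le
    rw [torusIntegral_succ hTor]
    have key : ∀ x ∈ sphere (c 0) r, (∯ y in T(c ∘ Fin.succ, (fun _ => r) ∘ Fin.succ), (∏ i, ((Fin.cons x y : Fin (n+1) → ℂ) i - w i)⁻¹) * f (Fin.cons x y)) = (x - w 0)⁻¹ • ((2 * π * I) ^ n * f (Fin.cons x (w ∘ Fin.succ))) := by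
      intro x hx
      have hcd : Differentiable ℂ (fun y : Fin n → ℂ => (Fin.cons x y : Fin (n+1) → ℂ)) := by
        rw [differentiable_pi]
        intro i
        refine Fin.cases ?_ (fun j => ?_) i
        · simp
        · simp only [Fin.cons_succ]; fun_prop
      have := ih (c ∘ Fin.succ) (w ∘ Fin.succ) r hr ((fun y : Fin n → ℂ => (Fin.cons x y : Fin (n+1) → ℂ)) ⁻¹' W)
        (hWo.preimage hcd.continuous) (by
          intro z hz
          apply hW
          intro i
          refine Fin.cases ?_ (fun j => ?_) i
          · simpa using (mem_sphere.1 hx).le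
          · simpa using hz j) (fun i => hw _) (fun y => f (Fin.cons x y))
          (hf.comp hcd.differentiableOn (mapsTo_preimage _ _))
      rw [← this, smul_eq_mul, ← torusIntegral_const_mul]
      congr 1
      ext y
      rw [Fin.prod_univ_succ]
      simp only [Fin.cons_zero, Fin.cons_succ, Function.comp]
      ring
    rw [circleIntegral.integral_congr hr.le key]
    have hcd : Differentiable ℂ (fun x : ℂ => (Fin.cons x (w ∘ Fin.succ) : Fin (n+1) → ℂ)) := by
        rw [differentiable_pi]
        intro i
        refine Fin.cases ?_ (fun j => ?_) i
        · simp only [Fin.cons_zero]; fun_prop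
        · simp only [Fin.cons_succ]; fun_prop
    have hm : ∀ x ∈ closedBall (c 0) r, (Fin.cons x (w ∘ Fin.succ) : Fin (n+1) → ℂ) ∈ W := by
      intro x hx
      apply hW
      intro i
      refine Fin.cases ?_ (fun j => ?_) i
      · simpa using hx
      · simpa using (hw j.succ).le
    have hd : ∀ x ∈ closedBall (c 0) r, DifferentiableAt ℂ (fun x : ℂ => (2 * π * I) ^ n * f (Fin.cons x (w ∘ Fin.succ))) x := by
      intro x hx
      have := (hf.differentiableAt (hWo.mem_nhds (hm x hx))).comp x (hcd x)
      exact this.const_mul _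
    rw [circleIntegral_sub_inv_smul_of_differentiable_on_off_countable Set.countable_empty (by simpa using hw 0)
      (fun x hx => (hd x hx).continuousAt.continuousWithinAt) (fun x hx => hd x (ball_subset_closedBall hx.1))]
    have : (Fin.cons (w 0) (w ∘ Fin.succ) : Fin (n+1) → ℂ) = w := Fin.cons_self_tail w
    rw [this, smul_eq_mul]; ring

/-- integration functional -/
noncomputable def osgJ (n : ℕ) : C(Icc (0 : Fin n → ℝ) (fun _ => 2 * π), ℂ) →L[ℂ] ℂ :=
  LinearMap.mkContinuous
    { toFun := fun h => ∫ θ, h θ ∂(Measure.comap Subtype.val (volume : Measure (Fin n → ℝ)))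
      map_add' := by
        intro x y
        have hfin : IsFiniteMeasure (Measure.comap (Subtype.val : Icc (0 : Fin n → ℝ) (fun _ => 2 * π) → (Fin n → ℝ)) volume) := by
          constructor
          rw [Measure.comap_apply _ Subtype.val_injective (fun s hs => (MeasurableEmbedding.subtype_coe measurableSet_Icc).measurableSet_image.2 hs) _ MeasurableSet.univ]
          rw [Set.image_univ, Subtype.range_coe]; exact isCompact_Icc.measure_lt_top
        simp only [ContinuousMap.add_apply]
        exact integral_add (x.continuous.integrable_of_hasCompactSupport (HasCompactSupport.of_compactSpace _))
          (y.continuous.integrable_of_hasCompactSupport (HasCompactSupport.of_compactSpace _))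
      map_smul' := by
        intro c x
        simp only [ContinuousMap.smul_apply, RingHom.id_apply]
        exact integral_smul c _ }
    ((Measure.comap (Subtype.val : Icc (0 : Fin n → ℝ) (fun _ => 2 * π) → (Fin n → ℝ)) volume).real univ) (by
      intro x
      have hfin : IsFiniteMeasure (Measure.comap (Subtype.val : Icc (0 : Fin n → ℝ) (fun _ => 2 * π) → (Fin n → ℝ)) volume) := by
          constructor
          rw [Measure.comap_apply _ Subtype.val_injective (fun s hs => (MeasurableEmbedding.subtype_coe measurableSet_Icc).measurableSet_image.2 hs) _ MeasurableSet.univ]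
          rw [Set.image_univ, Subtype.range_coe]; exact isCompact_Icc.measure_lt_top
      refine le_of_le_of_eq ?_ (mul_comm _ _)
      exact norm_integral_le_of_norm_le_const (Eventually.of_forall fun θ => x.norm_coe_le_norm θ))

lemma osgJ_apply (n : ℕ) (h : C(Icc (0 : Fin n → ℝ) (fun _ => 2 * π), ℂ)) (h' : (Fin n → ℝ) → ℂ) (hh : ∀ θ, h θ = h' θ) :
    osgJ n h = ∫ θ in Icc (0 : Fin n → ℝ) (fun _ => 2 * π), h' θ := by
  rw [← integral_subtype_comap measurableSet_Icc]
  show ∫ θ, h θ ∂_ = _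
  congr 1
  ext θ; exact hh θ

lemma osgood {n : ℕ} {f : (Fin n → ℂ) → ℂ} {c : Fin n → ℂ} {W : Set (Fin n → ℂ)} (hWo : IsOpen W)
    (hc : c ∈ W) (hf : DifferentiableOn ℂ f W) : AnalyticAt ℂ f c := by
  obtain ⟨r, hr, hrW⟩ := Metric.nhds_basis_closedBall.mem_iff.1 (hWo.mem_nhds hc)
  have hW : ∀ z : Fin n → ℂ, (∀ i, dist (z i) (c i) ≤ r) → z ∈ W := fun z hz =>
    hrW (by rw [mem_closedBall, dist_pi_le_iff hr.le]; exact hz)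
  let K := Icc (0 : Fin n → ℝ) (fun _ => 2 * π)
  let γ : Fin n → C(K, ℂ) := fun i => ⟨fun θ => torusMap c (fun _ => r) θ i,
    ((continuous_apply i).comp (torusMap_cont c (fun _ => r))).comp continuous_subtype_val⟩
  let g : C(K, ℂ) := ⟨fun θ => (∏ i, (r : ℂ) * exp ((θ : Fin n → ℝ) i * I) * I) * f (torusMap c (fun _ => r) θ), by
    apply Continuous.mul
    · refine continuous_finsetProd _ fun i _ => ?_
      have : Continuous (fun θ : Fin n → ℝ => (r : ℂ) * exp ((θ i : ℝ) * I) * I) := by fun_prop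
      exact this.comp continuous_subtype_val
    · exact (hf.continuousOn.comp_continuous (torusMap_cont c _) fun θ => hW _ fun i => (torusMap_dist c hr θ i).le).comp continuous_subtype_val⟩
  have hunit : ∀ i (z : ℂ), dist z (c i) < r → IsUnit (γ i - algebraMap ℂ C(K, ℂ) z) := by
    intro i z hz
    rw [ContinuousMap.isUnit_iff_forall_ne_zero]
    intro θ
    exact osg_ne hz (torusMap_dist c hr θ i)
  have hinv : ∀ i (z : ℂ), dist z (c i) < r → ∀ θ, (Ring.inverse (γ i - algebraMap ℂ C(K, ℂ) z)) θ = (torusMap c (fun _ => r) θ i - z)⁻¹ := by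
    intro i z hz θ
    have h1 := congrArg (fun h => h θ) (Ring.mul_inverse_cancel _ (hunit i z hz))
    refine eq_inv_of_mul_eq_one_right ?_
    exact h1
  have han : AnalyticAt ℂ (fun w : Fin n → ℂ => ((2 * π * I) ^ n)⁻¹ * osgJ n ((∏ i, Ring.inverse (γ i - algebraMap ℂ C(K, ℂ) (w i))) * g)) c := by
    refine analyticAt_const.mul ?_
    refine (ContinuousLinearMap.analyticAt (osgJ n) _).comp ?_
    refine AnalyticAt.mul ?_ analyticAt_const
    refine Finset.analyticAt_fun_prod _ fun i _ => ?_
    obtain ⟨v, hv⟩ := hunit i (c i) (by simpa using hr)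
    have h1 : AnalyticAt ℂ Ring.inverse (γ i - algebraMap ℂ C(K, ℂ) (c i)) := hv ▸ analyticAt_inverse v
    have h2 : AnalyticAt ℂ (fun w : Fin n → ℂ => γ i - algebraMap ℂ C(K, ℂ) (w i)) c := by
      refine analyticAt_const.sub ?_
      exact ContinuousLinearMap.analyticAt ((Algebra.linearMap ℂ C(K, ℂ)).toContinuousLinearMap.comp (ContinuousLinearMap.proj i)) c
    exact AnalyticAt.comp' (f := fun w : Fin n → ℂ => γ i - algebraMap ℂ C(K, ℂ) (w i)) h1 h2
  refine han.congr ?_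
  filter_upwards [Metric.ball_mem_nhds c hr] with w hw
  have hw' : ∀ i, dist (w i) (c i) < r := by rwa [mem_ball, dist_pi_lt_iff hr] at hw
  have h3 := osg_cauchy n c w r hr W hWo hW hw' f hf
  rw [inv_mul_eq_iff_eq_mul₀ (by simp [Real.pi_ne_zero]), ← h3, torusIntegral]
  apply osgJ_apply
  intro θ
  simp only [ContinuousMap.mul_apply, ContinuousMap.coe_prod, Finset.prod_apply, smul_eq_mul]
  rw [Finset.prod_congr rfl fun i _ => hinv i (w i) (hw' i) θ]
  show _ * ((∏ i, (r : ℂ) * exp ((θ : Fin n → ℝ) i * I) * I) * f (torusMap c (fun _ => r) θ)) = _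
  ring

lemma osgood_fin {E : Type*} [NormedAddCommGroup E] [NormedSpace ℂ E] [FiniteDimensional ℂ E] {f : E → ℂ} {c : E} {W : Set E} (hWo : IsOpen W)
    (hc : c ∈ W) (hf : DifferentiableOn ℂ f W) : AnalyticAt ℂ f c := by
  let e : E ≃L[ℂ] (Fin (Module.finrank ℂ E) → ℂ) := ContinuousLinearEquiv.ofFinrankEq (by simp)
  have h : AnalyticAt ℂ (f ∘ e.symm) (e c) := by
    refine osgood (W := e.symm ⁻¹' W) (hWo.preimage e.symm.continuous) (by simpa using hc) ?_
    exact hf.comp e.symm.differentiable.differentiableOn (mapsTo_preimage _ _)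
  have h2 := h.comp (e.toContinuousLinearMap.analyticAt c)
  refine h2.congr (Eventually.of_forall fun x => ?_)
  simp
end

end

section

section
open Filter Topology

/-- analytic with algebraic germ -/
def NashG {m : ℕ} (p : Em m) (f : Em m → ℂ) : Prop :=
  ∃ h : AnalyticAt ℂ f p, IsAlgebraic (MvPolynomial (Fin m ⊕ Fin m) ℂ) (germ p f h)

variable {m : ℕ} {p : Em m} {f g : Em m → ℂ}

lemma NashG.add (hf : NashG p f) (hg : NashG p g) : NashG p (f + g) := by
  obtain ⟨h1, h1'⟩ := hf
  obtain ⟨h2, h2'⟩ := hg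
  exact ⟨h1.add h2, by rw [germ_add h1 h2]; exact h1'.add h2'⟩

lemma NashG.mul (hf : NashG p f) (hg : NashG p g) : NashG p (f * g) := by
  obtain ⟨h1, h1'⟩ := hf
  obtain ⟨h2, h2'⟩ := hg
  exact ⟨h1.mul h2, by rw [germ_mul h1 h2]; exact h1'.mul h2'⟩

lemma NashG.const (c : ℂ) : NashG p (fun _ => c) := by
  refine ⟨analyticAt_const, ?_⟩
  have : germ p (fun _ => c) analyticAt_const = algebraMap (MvPolynomial (Fin m ⊕ Fin m) ℂ) (Og p) (MvPolynomial.C c) := by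
    rw [polAlg_eq, MvPolynomial.aeval_C]; rfl
  rw [this]
  exact isAlgebraic_algebraMap _

lemma NashG.sum {ι : Type*} (s : Finset ι) (F : ι → Em m → ℂ) (h : ∀ i ∈ s, NashG p (F i)) : NashG p (∑ i ∈ s, F i) := by
  classical
  induction s using Finset.induction_on with
  | empty => rw [Finset.sum_empty]; exact NashG.const 0
  | insert a s ha ih =>
    rw [Finset.sum_insert ha]
    exact (h a (by simp)).add (ih fun i hi => h i (by simp [hi]))

lemma NashG.prod {ι : Type*} (s : Finset ι) (F : ι → Em m → ℂ) (h : ∀ i ∈ s, NashG p (F i)) : NashG p (∏ i ∈ s, F i) := by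
  classical
  induction s using Finset.induction_on with
  | empty => rw [Finset.prod_empty]; exact NashG.const 1
  | insert a s ha ih =>
    rw [Finset.prod_insert ha]
    exact (h a (by simp)).mul (ih fun i hi => h i (by simp [hi]))

lemma NashG.inv (hf : NashG p f) (h0 : f p ≠ 0) : NashG p (f⁻¹) := by
  obtain ⟨h1, h1'⟩ := hf
  refine ⟨h1.inv h0, ?_⟩
  refine IsAlgebraic.of_mul (mem_nonZeroDivisors_of_ne_zero (germ_ne_zero h1 h0)) h1' ?_
  have : germ p f h1 * germ p f⁻¹ (h1.inv h0) = 1 := by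
    rw [← map_one (algebraMap ℂ (Og p)), ← germ_const, ← germ_mul, germ_eq]
    filter_upwards [h1.continuousAt.eventually_ne h0] with x hx
    simp [hx]
  rw [this]
  exact isAlgebraic_one

lemma NashG.deriv (hf : NashG p f) (v : Em m) : NashG p (fun x => fderiv ℂ f x v) := by
  obtain ⟨h1, h1'⟩ := hf
  exact ⟨an_fderiv h1 v, nash_deriv p v f h1 h1'⟩

lemma NashG.gMat (hf : NashG p f) (h0 : f p ≠ 0) (i j : Fin m) : NashG p (gMat m f i j) := by
  have h1 := (hf.inv h0).mul ((hf.deriv (0, Pi.single j 1)).deriv (Pi.single i 1, 0))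
  have h2 := (((hf.mul hf).inv (by simpa using h0)).mul (hf.deriv (Pi.single i 1, 0))).mul (hf.deriv (0, Pi.single j 1))
  convert h1.add ((NashG.const (-1)).mul h2) using 1
  ext x
  have e : pderivW m f j = fun x => fderiv ℂ f x (0, Pi.single j 1) := rfl
  simp only [_root_.gMat, pderivZ, e, pow_two, Pi.add_apply, Pi.mul_apply, Pi.inv_apply]
  ring

lemma NashG.detG (hf : NashG p f) (h0 : f p ≠ 0) : NashG p (detG m f) := by
  have : _root_.detG m f = ∑ σ : Equiv.Perm (Fin m), (fun _ => ((Equiv.Perm.sign σ : ℤ) : ℂ)) * ∏ i, _root_.gMat m f (σ i) i := by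
    ext x
    simp [_root_.detG, Matrix.det_apply']
  rw [this]
  exact NashG.sum _ _ fun σ _ => (NashG.const _).mul (NashG.prod _ _ fun i _ => hf.gMat h0 _ _)

lemma IsNashOnPair.nashG {W : Set (Em m)} (hW : IsOpen W) (hf : IsNashOnPair m W f) (hp : p ∈ W) : NashG p f := by
  obtain ⟨U, hU, hpU, hUW, P, hP, h⟩ := hf.2 p hp
  have han : AnalyticAt ℂ f p := osgood_fin hW hp hf.1
  exact ⟨han, nash_germ han U (hU.mem_nhds hpU) P hP h⟩
end

end

section

section
open Filter Topology PowerSeries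

/-- Taylor expansion with values in power series over the fraction field. -/
noncomputable def TM (s0 t0 : ℂ) : Og (s0, t0) →ₐ[ℂ] (FractionRing (Og s0))⟦X⟧ :=
  (PowerSeries.mapAlgHom (IsScalarTower.toAlgHom ℂ (Og s0) (FractionRing (Og s0)))).comp (Tay s0 t0)

lemma TM_apply (s0 t0 : ℂ) (a : Og (s0, t0)) :
    TM s0 t0 a = PowerSeries.map (algebraMap (Og s0) (FractionRing (Og s0))) (Tay s0 t0 a) := by
  rw [TM, AlgHom.comp_apply, PowerSeries.mapAlgHom_apply]; rfl

lemma TM_deriv (s0 t0 : ℂ) (a : Og (s0, t0)) :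
    TM s0 t0 (dirDer (s0, t0) (0, 1) a) = derivative _ (TM s0 t0 a) := by
  rw [TM_apply, TM_apply, Tay_deriv]
  ext n
  simp [coeff_derivative]

lemma an_fst {s0 t0 : ℂ} {f : ℂ → ℂ} (hf : AnalyticAt ℂ f s0) : AnalyticAt ℂ (fun x : ℂ × ℂ => f x.1) (s0, t0) :=
  AnalyticAt.comp' (f := fun x : ℂ × ℂ => x.1) (x := (s0, t0)) hf analyticAt_fst
lemma an_snd {s0 t0 : ℂ} {f : ℂ → ℂ} (hf : AnalyticAt ℂ f t0) : AnalyticAt ℂ (fun x : ℂ × ℂ => f x.2) (s0, t0) :=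
  AnalyticAt.comp' (f := fun x : ℂ × ℂ => x.2) (x := (s0, t0)) hf analyticAt_snd

/-- germ of function of the first variable -/
noncomputable def gfst (s0 t0 : ℂ) (f : ℂ → ℂ) (hf : AnalyticAt ℂ f s0) : Og (s0, t0) :=
  germ (s0, t0) (fun x => f x.1) (an_fst hf)
/-- germ of function of the second variable -/
noncomputable def gsnd (s0 t0 : ℂ) (f : ℂ → ℂ) (hf : AnalyticAt ℂ f t0) : Og (s0, t0) :=
  germ (s0, t0) (fun x => f x.2) (an_snd hf)

lemma TM_fst (s0 t0 : ℂ) (f : ℂ → ℂ) (hf : AnalyticAt ℂ f s0) :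
    TM s0 t0 (gfst s0 t0 f hf) = C (algebraMap _ _ (germ s0 f hf)) := by
  rw [gfst, TM_apply, Tay_fst s0 t0 f hf, PowerSeries.map_C]

lemma TM_snd (s0 t0 : ℂ) (f : ℂ → ℂ) (hf : AnalyticAt ℂ f t0) :
    TM s0 t0 (gsnd s0 t0 f hf) ∈ Set.range (PowerSeries.map (algebraMap ℂ (FractionRing (Og s0)))) := by
  obtain ⟨b, hb⟩ := Tay_snd s0 t0 f hf (an_snd hf)
  refine ⟨b, ?_⟩
  rw [gsnd, TM_apply, ← hb]
  ext n
  simp only [coeff_map]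
  exact IsScalarTower.algebraMap_apply _ _ _ _

lemma TM_ne (s0 t0 : ℂ) (f : ℂ × ℂ → ℂ) (hf : AnalyticAt ℂ f (s0, t0)) (h0 : f (s0, t0) ≠ 0) :
    constantCoeff (TM s0 t0 (germ _ f hf)) ≠ 0 := by
  rw [TM_apply, ← coeff_zero_eq_constantCoeff_apply, coeff_map, coeff_zero_eq_constantCoeff_apply, Tay_constCoeff]
  rw [Ne, FaithfulSMul.algebraMap_eq_zero_iff]
  exact germ_ne_zero _ h0

lemma const_vanish (s0 : ℂ) {n : ℕ} (f : Fin n → ℂ → ℂ) (hf : ∀ j, AnalyticAt ℂ (f j) s0) (h0 : ∀ j, f j s0 = 0)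
    (c : Fin n → ℂ) (d : ℂ) (h : ∑ j, germ s0 (f j) (hf j) * algebraMap ℂ (Og s0) (c j) = algebraMap ℂ (Og s0) d) :
    ∑ j, germ s0 (f j) (hf j) * algebraMap ℂ (Og s0) (c j) = 0 := by
  let ε : Og s0 →ₐ[ℂ] Og s0 := pull s0 (fun _ => s0) analyticAt_const
  have h1 : ∀ j, ε (germ s0 (f j) (hf j)) = 0 := by
    intro j
    have : ε (germ s0 (f j) (hf j)) = germ s0 (f j ∘ fun _ => s0) (AnalyticAt.comp (x := s0) (hf j) analyticAt_const) := pull_germ s0 (fun _ => s0) analyticAt_const (f j) (hf j)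
    rw [this, germ_zero]
    exact Eventually.of_forall fun x => h0 j
  have h2 := congrArg ε h
  rw [map_sum] at h2
  simp only [map_mul, h1, AlgHom.commutes, zero_mul, Finset.sum_const_zero] at h2
  rw [h, ← h2]

lemma core_germ (s0 t0 : ℂ) {m n k : ℕ} (f f' : Fin n → ℂ → ℂ) (hf : ∀ j, AnalyticAt ℂ (f j) s0) (hf' : ∀ j, AnalyticAt ℂ (f' j) t0)
    (e e' : Fin k → ℂ → ℂ) (he : ∀ j, AnalyticAt ℂ (e j) s0) (he' : ∀ j, AnalyticAt ℂ (e' j) t0)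
    (G1 G1' : ℂ → Fin m → ℂ) (hG1 : AnalyticAt ℂ G1 s0) (hG1' : AnalyticAt ℂ G1' t0)
    (Φ D : Em m → ℂ) (hΦ : NashG (G1 s0, G1' t0) Φ) (hD : NashG (G1 s0, G1' t0) D)
    (hΦ0 : Φ (G1 s0, G1' t0) ≠ 0) (hD0 : D (G1 s0, G1' t0) ≠ 0)
    (hΦa : AnalyticAt ℂ (fun x : ℂ × ℂ => Φ (G1 x.1, G1' x.2)) (s0, t0))
    (hDa : AnalyticAt ℂ (fun x : ℂ × ℂ => D (G1 x.1, G1' x.2)) (s0, t0))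
    (L1 L2 L3 y R : Og (s0, t0)) (P Q : Polynomial ℂ) (c1 c2 c3 l : ℂ)
    (g : Og (s0, t0)) (hg : g = ∑ j, gfst s0 t0 (e j) (he j) * gsnd s0 t0 (e' j) (he' j))
    (hR0 : constantCoeff (TM s0 t0 R) ≠ 0) (hy0 : constantCoeff (TM s0 t0 y) ≠ 0)
    (hQ : Polynomial.aeval (g * y) Q ≠ 0)
    (hRPQ : R * Polynomial.aeval (g * y) Q = Polynomial.aeval (g * y) P)
    (hL1 : dirDer (s0, t0) (0, 1) L1 * germ _ _ hDa = dirDer (s0, t0) (0, 1) (germ _ _ hDa))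
    (hL2 : dirDer (s0, t0) (0, 1) L2 * germ _ _ hΦa = dirDer (s0, t0) (0, 1) (germ _ _ hΦa))
    (hL3 : dirDer (s0, t0) (0, 1) L3 * R = dirDer (s0, t0) (0, 1) R)
    (hyL : dirDer (s0, t0) (0, 1) y = algebraMap ℂ _ l * y * dirDer (s0, t0) (0, 1) L2)
    (h : ℂ → ℂ) (hh : AnalyticAt ℂ h t0)
    (hH : dirDer (s0, t0) (0, 1) (∑ j, gfst s0 t0 (f j) (hf j) * gsnd s0 t0 (f' j) (hf' j)
      - (algebraMap ℂ _ c1 * L1 + algebraMap ℂ _ c2 * L2 + algebraMap ℂ _ c3 * L3)) = gsnd s0 t0 h hh) :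
    ∀ᶠ x : ℂ × ℂ in 𝓝 (s0, t0), ∑ j, (f j x.1 - f j s0) * (f' j x.2 - f' j t0) = 0 := by
  let T := TM s0 t0
  have hTinj : Function.Injective T := by
    intro a b hab
    have hab' : TM s0 t0 a = TM s0 t0 b := hab
    rw [TM_apply, TM_apply] at hab'
    exact Tay_inj s0 t0 (PowerSeries.map_injective _ (IsFractionRing.injective (Og s0) (FractionRing (Og s0))) hab')
  let M := FractionRing (Og s0)
  let S0 : Subalgebra M M⟦X⟧ := Algebra.adjoin M (Set.range (PowerSeries.map (algebraMap ℂ M)))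
  have hfstS : ∀ u hu, T (gfst s0 t0 u hu) ∈ S0 := by
    intro u hu
    have := TM_fst s0 t0 u hu
    rw [show T _ = _ from this]
    exact S0.algebraMap_mem (algebraMap (Og s0) M (germ s0 u hu))
  have hsndS : ∀ u hu, T (gsnd s0 t0 u hu) ∈ S0 := fun u hu => Algebra.subset_adjoin (TM_snd s0 t0 u hu)
  -- shifted second factors
  have hf2 : ∀ j, AnalyticAt ℂ (fun t => f' j t - f' j t0) t0 := fun j => (hf' j).sub analyticAt_const
  have hf1 : ∀ j, AnalyticAt ℂ (fun s => f j s - f j s0) s0 := fun j => (hf j).sub analyticAt_const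
  let b0 : Og (s0, t0) := ∑ j, gfst s0 t0 (f j) (hf j) * gsnd s0 t0 _ (hf2 j)
  have hsub2 : ∀ j, gsnd s0 t0 _ (hf2 j) = gsnd s0 t0 (f' j) (hf' j) - algebraMap ℂ _ (f' j t0) := by
    intro j; rfl
  have hsub1 : ∀ j, germ s0 _ (hf1 j) = germ s0 (f j) (hf j) - algebraMap ℂ _ (f j s0) := by
    intro j; rfl
  have hB0 : constantCoeff (T b0) = 0 := by
    simp only [b0, map_sum, map_mul]
    refine Finset.sum_eq_zero fun j _ => ?_
    have : constantCoeff (T (gsnd s0 t0 _ (hf2 j))) = 0 := by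
      show constantCoeff (TM s0 t0 _) = 0
      rw [gsnd, TM_apply, ← coeff_zero_eq_constantCoeff_apply, coeff_map, coeff_zero_eq_constantCoeff_apply, Tay_constCoeff]
      rw [FaithfulSMul.algebraMap_eq_zero_iff, germ_zero]
      exact Eventually.of_forall fun x => by simp
    rw [this, mul_zero]
  have hfstD : ∀ u hu, dirDer (s0, t0) (0, 1) (gfst s0 t0 u hu) = 0 := by
    intro u hu
    apply hTinj
    show TM s0 t0 _ = TM s0 t0 0
    rw [TM_deriv, TM_fst, map_zero]; simp
  have hscalar : ∀ c : ℂ, T (algebraMap ℂ _ c) = C (algebraMap ℂ M c) := by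
    intro c
    rw [AlgHom.commutes]
    exact PowerSeries.algebraMap_apply
  have hal := fun (u : Em m → ℂ) (hu : NashG (G1 s0, G1' t0) u) =>
    nash_sub (S := S0) (T := M⟦X⟧) Subtype.val_injective (s0, t0) (G1 s0, G1' t0)
      (fun x : ℂ × ℂ => (G1 x.1, G1' x.2))
      (AnalyticAt.prod (AnalyticAt.comp' (f := fun x : ℂ × ℂ => x.1) (x := (s0, t0)) hG1 analyticAt_fst)
        (AnalyticAt.comp' (f := fun x : ℂ × ℂ => x.2) (x := (s0, t0)) hG1' analyticAt_snd)) rfl T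
      (by
        rintro (i | i)
        · exact ⟨⟨_, hfstS (fun s => G1 s i) ((ContinuousLinearMap.proj (R := ℂ) (φ := fun _ : Fin m => ℂ) i).analyticAt _ |>.comp hG1)⟩, rfl⟩
        · exact ⟨⟨_, hsndS (fun s => G1' s i) ((ContinuousLinearMap.proj (R := ℂ) (φ := fun _ : Fin m => ℂ) i).analyticAt _ |>.comp hG1')⟩, rfl⟩)
      u hu.1 hu.2
  have core := algebraic_core (k := ℂ) (M := M) (T b0) (T L1) (T L2) (T L3) (T (germ _ _ hDa)) (T (germ _ _ hΦa)) (T R) (T y) (T g)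
    P Q c1 c2 c3 l (TM_ne _ _ _ hDa hD0) (TM_ne _ _ _ hΦa hΦ0) hR0 hy0
    (by
      rw [← map_mul, Polynomial.aeval_algHom_apply]
      exact (map_ne_zero_iff T hTinj).2 hQ)
    (by rw [← map_mul, Polynomial.aeval_algHom_apply, Polynomial.aeval_algHom_apply, ← map_mul, hRPQ])
    (by show derivative M (TM s0 t0 _) * _ = derivative M (TM s0 t0 _)
        rw [← TM_deriv, ← TM_deriv, ← hL1, map_mul])
    (by show derivative M (TM s0 t0 _) * _ = derivative M (TM s0 t0 _)
        rw [← TM_deriv, ← TM_deriv, ← hL2, map_mul])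
    (by show derivative M (TM s0 t0 _) * _ = derivative M (TM s0 t0 _)
        rw [← TM_deriv, ← TM_deriv, ← hL3, map_mul])
    (by show derivative M (TM s0 t0 _) = _ * _ * derivative M (TM s0 t0 _)
        rw [← TM_deriv, ← TM_deriv, hyL, map_mul, map_mul, ← hscalar])
    hB0
    (by
      rw [← hscalar, ← hscalar, ← hscalar, ← map_mul, ← map_mul, ← map_mul, ← map_add, ← map_add, ← map_sub]
      show derivative M (TM s0 t0 _) ∈ _
      rw [← TM_deriv]
      have : dirDer (s0, t0) (0, 1) (b0 - (algebraMap ℂ _ c1 * L1 + algebraMap ℂ _ c2 * L2 + algebraMap ℂ _ c3 * L3)) = gsnd s0 t0 h hh := by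
        rw [← hH, map_sub, map_sub]
        congr 1
        simp only [b0, map_sum]
        refine Finset.sum_congr rfl fun j _ => ?_
        rw [hsub2, mul_sub, map_sub, Derivation.leibniz _ _ (algebraMap ℂ _ _), hfstD, Derivation.map_algebraMap]
        simp
      rw [this]
      exact TM_snd _ _ _ _)
    S0 rfl (hal D hD) (hal Φ hΦ)
    (by
      rw [hg, map_sum]
      exact S0.sum_mem fun j _ => by rw [map_mul]; exact S0.mul_mem (hfstS _ _) (hsndS _ _))
    (by
      show T (∑ j, _) ∈ S0
      rw [map_sum]
      exact S0.sum_mem fun j _ => by rw [map_mul]; exact S0.mul_mem (hfstS _ _) (hsndS _ _))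
  -- conclusion
  choose φ hφ using fun j => Tay_snd s0 t0 _ (hf2 j) (an_snd (hf2 j))
  have hTb0 : Tay s0 t0 b0 = ∑ j, C (germ s0 (f j) (hf j)) * PowerSeries.map (algebraMap ℂ (Og s0)) (φ j) := by
    show Tay s0 t0 (∑ j, _) = _
    rw [map_sum]
    refine Finset.sum_congr rfl fun j _ => ?_
    rw [map_mul, hφ, gfst, Tay_fst s0 t0 (f j) (hf j)]; rfl
  have hco : ∀ N, ∃ d : ℂ, coeff N (Tay s0 t0 b0) = algebraMap ℂ (Og s0) d := by
    intro N
    obtain ⟨d, hd⟩ := core N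
    refine ⟨d, ?_⟩
    have hd' : algebraMap ℂ M d = coeff N (TM s0 t0 b0) := hd
    rw [TM_apply, coeff_map, IsScalarTower.algebraMap_apply ℂ (Og s0) M] at hd'
    exact (IsFractionRing.injective (Og s0) M hd').symm
  have hz : Tay s0 t0 (∑ j, gfst s0 t0 _ (hf1 j) * gsnd s0 t0 _ (hf2 j)) = 0 := by
    have h1 : Tay s0 t0 (∑ j, gfst s0 t0 _ (hf1 j) * gsnd s0 t0 _ (hf2 j)) = ∑ j, C (germ s0 _ (hf1 j)) * PowerSeries.map (algebraMap ℂ (Og s0)) (φ j) := by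
      rw [map_sum]
      refine Finset.sum_congr rfl fun j _ => ?_
      rw [map_mul, hφ, gfst, Tay_fst s0 t0 _ (hf1 j)]; rfl
    rw [h1]
    ext N
    obtain ⟨d, hd⟩ := hco N
    rw [hTb0, map_sum] at hd
    simp only [coeff_C_mul, coeff_map] at hd
    rw [map_sum, map_zero]
    simp only [coeff_C_mul, coeff_map]
    refine const_vanish s0 (fun j s => f j s - f j s0) hf1 (by simp) _ (d - ∑ j, f j s0 * coeff N (φ j)) ?_
    rw [map_sub, ← hd, map_sum, ← Finset.sum_sub_distrib]
    refine Finset.sum_congr rfl fun j _ => ?_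
    rw [hsub1, sub_mul, map_mul]
  have hz' : (∑ j, gfst s0 t0 _ (hf1 j) * gsnd s0 t0 _ (hf2 j)) = 0 := Tay_inj s0 t0 (by rw [hz, map_zero])
  have hanp : ∀ j, AnalyticAt ℂ (fun x : ℂ × ℂ => (f j x.1 - f j s0) * (f' j x.2 - f' j t0)) (s0, t0) := fun j =>
    (an_fst (hf1 j)).mul (an_snd (hf2 j))
  have hgs : ∀ s : Finset (Fin n), ∃ hs : AnalyticAt ℂ (fun x : ℂ × ℂ => ∑ j ∈ s, (f j x.1 - f j s0) * (f' j x.2 - f' j t0)) (s0, t0),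
      germ (s0, t0) _ hs = ∑ j ∈ s, gfst s0 t0 _ (hf1 j) * gsnd s0 t0 _ (hf2 j) := by
    intro s
    induction s using Finset.induction_on with
    | empty =>
      refine ⟨by simpa using analyticAt_const, ?_⟩
      rw [Finset.sum_empty, germ_zero]
      exact Eventually.of_forall fun x => by simp
    | insert a s ha ih =>
      obtain ⟨h1, h2⟩ := ih
      have e1 : (fun x : ℂ × ℂ => ∑ j ∈ insert a s, (f j x.1 - f j s0) * (f' j x.2 - f' j t0)) = (fun x : ℂ × ℂ => (f a x.1 - f a s0) * (f' a x.2 - f' a t0)) + (fun x : ℂ × ℂ => ∑ j ∈ s, (f j x.1 - f j s0) * (f' j x.2 - f' j t0)) := by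
        ext x; rw [Finset.sum_insert ha]; rfl
      rw [e1, Finset.sum_insert ha, ← h2]
      exact ⟨(hanp a).add h1, germ_add (hanp a) h1⟩
  obtain ⟨h1, h2⟩ := hgs Finset.univ
  rw [hz', germ_zero] at h2
  exact h2
end

end

section

section
open Filter Topology PowerSeries

variable {E : Type*} [NormedAddCommGroup E] [NormedSpace ℂ E]

lemma dirDer_exp (p v : E) (L : E → ℂ) (hL : AnalyticAt ℂ L p) (he : AnalyticAt ℂ (fun x => Complex.exp (L x)) p) :
    dirDer p v (germ p _ he) = germ p _ he * dirDer p v (germ p L hL) := by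
  rw [dirDer_germ, dirDer_germ, ← germ_mul, germ_eq]
  filter_upwards [hL.eventually_analyticAt] with x hx
  rw [hx.differentiableAt.hasFDerivAt.cexp.fderiv]
  simp

lemma germ_sum {ι : Type*} (p : E) (s : Finset ι) (F : ι → E → ℂ) (hF : ∀ i, AnalyticAt ℂ (F i) p)
    (h : AnalyticAt ℂ (fun x => ∑ i ∈ s, F i x) p) : germ p _ h = ∑ i ∈ s, germ p (F i) (hF i) := by
  classical
  induction s using Finset.induction_on with
  | empty =>
    rw [Finset.sum_empty, germ_zero]
    exact Eventually.of_forall fun x => by simp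
  | insert a s ha ih =>
    have h1 : AnalyticAt ℂ (fun x => ∑ i ∈ s, F i x) p := Finset.analyticAt_fun_sum _ fun i _ => hF i
    rw [Finset.sum_insert ha, ← ih h1, ← germ_add, germ_eq]
    exact Eventually.of_forall fun x => by simp [Finset.sum_insert ha]

lemma an_eval {p : E} {X : E → ℂ} (hX : AnalyticAt ℂ X p) (Q : Polynomial ℂ) : AnalyticAt ℂ (fun x => Q.eval (X x)) p := by
  have := hX.aeval_polynomial Q
  simpa using this

lemma germ_eval (p : E) (X : E → ℂ) (hX : AnalyticAt ℂ X p) (Q : Polynomial ℂ) :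
    germ p _ (an_eval hX Q) = Polynomial.aeval (germ p X hX) Q := by
  induction Q using Polynomial.induction_on' with
  | add a b ha hb =>
    rw [map_add, ← ha, ← hb, ← germ_add, germ_eq]
    exact Eventually.of_forall fun x => by simp
  | monomial n c =>
    rw [Polynomial.aeval_monomial]
    have : ∀ n : ℕ, germ p (X ^ n) (hX.pow n) = (germ p X hX) ^ n := fun n => rfl
    rw [← this, ← germ_const, ← germ_mul, germ_eq]
    exact Eventually.of_forall fun x => by simp

lemma core_fun (s0 t0 : ℂ) {m n k : ℕ} (f f' : Fin n → ℂ → ℂ) (hf : ∀ j, AnalyticAt ℂ (f j) s0) (hf' : ∀ j, AnalyticAt ℂ (f' j) t0)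
    (e e' : Fin k → ℂ → ℂ) (he : ∀ j, AnalyticAt ℂ (e j) s0) (he' : ∀ j, AnalyticAt ℂ (e' j) t0)
    (G1 G1' : ℂ → Fin m → ℂ) (hG1 : AnalyticAt ℂ G1 s0) (hG1' : AnalyticAt ℂ G1' t0)
    (Φ D : Em m → ℂ) (hΦ : NashG (G1 s0, G1' t0) Φ) (hD : NashG (G1 s0, G1' t0) D)
    (L1 L2 L3 : ℂ × ℂ → ℂ) (aL1 : AnalyticAt ℂ L1 (s0, t0)) (aL2 : AnalyticAt ℂ L2 (s0, t0)) (aL3 : AnalyticAt ℂ L3 (s0, t0))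
    (P Q : Polynomial ℂ) (c1 c2 c3 l : ℂ)
    (eL1 : ∀ᶠ x in 𝓝 (s0, t0), Complex.exp (L1 x) = D (G1 x.1, G1' x.2))
    (eL2 : ∀ᶠ x in 𝓝 (s0, t0), Complex.exp (L2 x) = Φ (G1 x.1, G1' x.2))
    (X : ℂ × ℂ → ℂ) (hX : X = fun x => (∑ j, e j x.1 * e' j x.2) * Complex.exp (l * L2 x))
    (hQ : Q.eval (X (s0, t0)) ≠ 0)
    (eL3 : ∀ᶠ x in 𝓝 (s0, t0), Complex.exp (L3 x) * Q.eval (X x) = P.eval (X x))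
    (H : ℂ × ℂ → ℂ) (hHdef : H = fun x => ∑ j, f j x.1 * f' j x.2 - (c1 * L1 x + c2 * L2 x + c3 * L3 x))
    (h : ℂ → ℂ) (hh : AnalyticAt ℂ h t0)
    (hH : ∀ᶠ x in 𝓝 (s0, t0), fderiv ℂ H x (0, 1) = h x.2) :
    ∀ᶠ x : ℂ × ℂ in 𝓝 (s0, t0), ∑ j, (f j x.1 - f j s0) * (f' j x.2 - f' j t0) = 0 := by
  have haG : AnalyticAt ℂ (fun x : ℂ × ℂ => (G1 x.1, G1' x.2)) (s0, t0) :=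
    (AnalyticAt.prod (AnalyticAt.comp' (f := fun x : ℂ × ℂ => x.1) (x := (s0, t0)) hG1 analyticAt_fst)
        (AnalyticAt.comp' (f := fun x : ℂ × ℂ => x.2) (x := (s0, t0)) hG1' analyticAt_snd))
  have hΦa : AnalyticAt ℂ (fun x : ℂ × ℂ => Φ (G1 x.1, G1' x.2)) (s0, t0) := AnalyticAt.comp (x := (s0, t0)) hΦ.1 haG
  have hDa : AnalyticAt ℂ (fun x : ℂ × ℂ => D (G1 x.1, G1' x.2)) (s0, t0) := AnalyticAt.comp (x := (s0, t0)) hD.1 haG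
  have hexp : ∀ {L : ℂ × ℂ → ℂ}, AnalyticAt ℂ L (s0, t0) → AnalyticAt ℂ (fun x => Complex.exp (L x)) (s0, t0) := fun hL => hL.cexp
  have aLl : AnalyticAt ℂ (fun x => l * L2 x) (s0, t0) := analyticAt_const.mul aL2
  have hge : ∀ j, AnalyticAt ℂ (fun x : ℂ × ℂ => e j x.1 * e' j x.2) (s0, t0) := fun j => (an_fst (he j)).mul (an_snd (he' j))
  have hgf : ∀ j, AnalyticAt ℂ (fun x : ℂ × ℂ => f j x.1 * f' j x.2) (s0, t0) := fun j => (an_fst (hf j)).mul (an_snd (hf' j))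
  have hges : AnalyticAt ℂ (fun x : ℂ × ℂ => ∑ j, e j x.1 * e' j x.2) (s0, t0) := Finset.analyticAt_fun_sum _ fun j _ => hge j
  have hgfs : AnalyticAt ℂ (fun x : ℂ × ℂ => ∑ j, f j x.1 * f' j x.2) (s0, t0) := Finset.analyticAt_fun_sum _ fun j _ => hgf j
  have hXa : AnalyticAt ℂ X (s0, t0) := by rw [hX]; exact hges.mul (hexp aLl)
  have hXg : germ _ _ hXa = germ _ _ hges * germ _ _ (hexp aLl) := by
    rw [← germ_mul, germ_eq, hX]; exact EventuallyEq.rfl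
  have hHa : AnalyticAt ℂ H (s0, t0) := by
    rw [hHdef]
    exact hgfs.sub (((analyticAt_const.mul aL1).add (analyticAt_const.mul aL2)).add (analyticAt_const.mul aL3))
  have hg1 : germ _ _ hDa = germ _ _ (hexp aL1) := by
    rw [germ_eq]; filter_upwards [eL1] with x hx using hx.symm
  have hg2 : germ _ _ hΦa = germ _ _ (hexp aL2) := by
    rw [germ_eq]; filter_upwards [eL2] with x hx using hx.symm
  refine core_germ s0 t0 f f' hf hf' e e' he he' G1 G1' hG1 hG1' Φ D hΦ hD ?_ ?_ hΦa hDa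
    (germ _ _ aL1) (germ _ _ aL2) (germ _ _ aL3) (germ _ _ (hexp aLl)) (germ _ _ (hexp aL3)) P Q c1 c2 c3 l
    (germ _ _ hges) ?_ ?_ ?_ ?_ ?_ ?_ ?_ ?_ ?_ h hh ?_
  · have := eL2.self_of_nhds
    rw [← this]; exact Complex.exp_ne_zero _
  · have := eL1.self_of_nhds
    rw [← this]; exact Complex.exp_ne_zero _
  · exact germ_sum (s0, t0) Finset.univ _ hge hges
  · exact TM_ne _ _ _ _ (Complex.exp_ne_zero _)
  · exact TM_ne _ _ _ _ (Complex.exp_ne_zero _)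
  · rw [← hXg, ← germ_eval]
    exact germ_ne_zero _ hQ
  · rw [← hXg, ← germ_eval, ← germ_eval, ← germ_mul, germ_eq]
    exact eL3
  · rw [hg1, dirDer_exp _ _ _ aL1, mul_comm]
  · rw [hg2, dirDer_exp _ _ _ aL2, mul_comm]
  · rw [dirDer_exp _ _ _ aL3, mul_comm]
  · rw [dirDer_exp _ _ _ aLl]
    have : germ _ _ aLl = algebraMap ℂ _ l * germ _ _ aL2 := rfl
    rw [this, Derivation.leibniz, Derivation.map_algebraMap]
    simp only [smul_zero, add_zero, smul_eq_mul]
    ring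
  · have e1 : (∑ j, gfst s0 t0 (f j) (hf j) * gsnd s0 t0 (f' j) (hf' j)) = germ _ _ hgfs :=
      (germ_sum (s0, t0) Finset.univ _ hgf hgfs).symm
    have e2 : germ _ _ hHa = germ _ _ hgfs - (algebraMap ℂ _ c1 * germ _ _ aL1 + algebraMap ℂ _ c2 * germ _ _ aL2 + algebraMap ℂ _ c3 * germ _ _ aL3) := by
      subst hHdef; rfl
    rw [e1, ← e2, dirDer_germ, gsnd, germ_eq]
    exact hH
end

end

section

section
open Filter Topology

/-- diagonal embedding -/
noncomputable def dlt : ℂ →L[ℝ] ℂ × ℂ :=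
  (ContinuousLinearMap.id ℝ ℂ).prod (Complex.conjCLE : ℂ →L[ℝ] ℂ)

lemma dlt_apply (s : ℂ) : dlt s = (s, (starRingEnd ℂ) s) := rfl

lemma lap_congr {v w : ℂ → ℝ} {s : ℂ} (h : v =ᶠ[𝓝 s] w) : lap v s = lap w s := by
  unfold lap
  have h1 : ∀ c : ℂ, (fun t => fderiv ℝ v t c) =ᶠ[𝓝 s] (fun t => fderiv ℝ w t c) := by
    intro c
    filter_upwards [h.fderiv (𝕜 := ℝ)] with x hx
    rw [hx]
  rw [(h1 1).fderiv_eq, (h1 Complex.I).fderiv_eq]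

lemma diag_fderiv {H : ℂ × ℂ → ℂ} {s : ℂ} (hH : DifferentiableAt ℂ H (dlt s)) (c : ℂ) :
    fderiv ℝ (fun t => (H (dlt t)).re) s c = (fderiv ℂ H (dlt s) (dlt c)).re := by
  have h1 := (hH.hasFDerivAt.restrictScalars ℝ).comp s dlt.hasFDerivAt
  have h2 := Complex.reCLM.hasFDerivAt.comp s h1
  have h3 : HasFDerivAt (fun t => (H (dlt t)).re) _ s := h2
  rw [h3.fderiv]
  rfl

lemma lap_diag {H : ℂ × ℂ → ℂ} {s : ℂ} (hH : AnalyticAt ℂ H (dlt s)) :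
    lap (fun t => (H (dlt t)).re) s = 4 * (fderiv ℂ (fun x => fderiv ℂ H x (0, 1)) (dlt s) (1, 0)).re := by
  have h1 : ∀ c : ℂ, fderiv ℝ (fun t => fderiv ℝ (fun t => (H (dlt t)).re) t c) s c =
      (fderiv ℂ (fderiv ℂ H) (dlt s) (dlt c) (dlt c)).re := by
    intro c
    have he : (fun t => fderiv ℝ (fun t => (H (dlt t)).re) t c) =ᶠ[𝓝 s] fun t => ((fun x => fderiv ℂ H x (dlt c)) (dlt t)).re := by
      filter_upwards [dlt.continuous.continuousAt.eventually hH.eventually_analyticAt] with t ht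
      exact diag_fderiv ht.differentiableAt c
    rw [he.fderiv_eq, diag_fderiv (an_fderiv hH _).differentiableAt]
    rw [fderiv_clm_apply hH.fderiv.differentiableAt (differentiableAt_const _)]
    simp
  have h2 : fderiv ℂ (fun x => fderiv ℂ H x (0, 1)) (dlt s) (1, 0) = fderiv ℂ (fderiv ℂ H) (dlt s) (1, 0) (0, 1) := by
    rw [fderiv_clm_apply hH.fderiv.differentiableAt (differentiableAt_const _)]
    simp
  have hsym : fderiv ℂ (fderiv ℂ H) (dlt s) (1, 0) (0, 1) = fderiv ℂ (fderiv ℂ H) (dlt s) (0, 1) (1, 0) := by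
    have := (hH.contDiffAt (n := 2)).isSymmSndFDerivAt (by simp [minSmoothness])
    exact this _ _
  rw [h2]
  unfold lap
  rw [h1, h1]
  have e1 : dlt 1 = (1, 0) + (0, 1) := by simp [dlt_apply]
  have eI : dlt Complex.I = Complex.I • ((1, 0) - (0, 1) : ℂ × ℂ) := by simp [dlt_apply]
  rw [e1, eI]
  simp only [map_add, map_sub, map_smul, ContinuousLinearMap.add_apply, ContinuousLinearMap.sub_apply, ContinuousLinearMap.smul_apply, smul_eq_mul]
  rw [← hsym]
  simp
  ring

/-- mixed derivative from real-valuedness on the diagonal -/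
lemma mixed_im {H : ℂ × ℂ → ℂ} {s : ℂ} (hH : AnalyticAt ℂ H (dlt s)) (hr : ∀ᶠ t in 𝓝 s, (H (dlt t)).im = 0) :
    (fderiv ℂ (fun x => fderiv ℂ H x (0, 1)) (dlt s) (1, 0)).im = 0 := by
  have h1 : AnalyticAt ℂ (fun x => -Complex.I * H x) (dlt s) := analyticAt_const.mul hH
  have h2 := lap_diag h1
  have h3 : (fun t => (-Complex.I * H (dlt t)).re) =ᶠ[𝓝 s] fun _ => 0 := by
    filter_upwards [hr] with t ht
    simp [ht]
  rw [lap_congr h3] at h2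
  have h4 : (fun x => fderiv ℂ (fun x => -Complex.I * H x) x (0, 1)) =ᶠ[𝓝 (dlt s)] fun x => -Complex.I * fderiv ℂ H x (0, 1) := by
    filter_upwards [hH.eventually_analyticAt] with x hx
    rw [fderiv_const_mul hx.differentiableAt]; rfl
  rw [h4.fderiv_eq, fderiv_const_mul (an_fderiv hH _).differentiableAt] at h2
  simp [lap] at h2
  exact h2

lemma real_line_zero {g : ℂ → ℂ} {a r : ℝ} (hr : 0 < r) (hg : AnalyticOnNhd ℂ g (Metric.ball (a : ℂ) r))
    (h : ∀ x : ℝ, (x : ℂ) ∈ Metric.ball (a : ℂ) r → g x = 0) : ∀ z ∈ Metric.ball (a : ℂ) r, g z = 0 := by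
  refine hg.eqOn_zero_of_preconnected_of_frequently_eq_zero (convex_ball _ _).isPreconnected (Metric.mem_ball_self hr) ?_
  have ht : Tendsto (fun x : ℝ => (x : ℂ)) (𝓝[≠] a) (𝓝[≠] (a : ℂ)) := by
    refine tendsto_nhdsWithin_of_tendsto_nhds_of_eventually_within _ ?_ ?_
    · exact (Complex.continuous_ofReal.tendsto a).mono_left nhdsWithin_le_nhds
    · filter_upwards [self_mem_nhdsWithin] with x hx
      simpa using hx
  refine ht.frequently (Eventually.frequently ?_)
  have : ∀ᶠ x : ℝ in 𝓝 a, (x : ℂ) ∈ Metric.ball (a : ℂ) r :=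
    (Complex.continuous_ofReal.tendsto a).eventually (Metric.ball_mem_nhds _ hr)
  exact (this.filter_mono nhdsWithin_le_nhds).mono h

lemma diag_zero {K : ℂ × ℂ → ℂ} {s0 : ℂ} (hK : AnalyticAt ℂ K (dlt s0)) (h : ∀ᶠ s in 𝓝 s0, K (dlt s) = 0) :
    ∀ᶠ x in 𝓝 (dlt s0), K x = 0 := by
  -- linear change of variables
  let A : ℂ × ℂ →L[ℂ] ℂ × ℂ :=
    (ContinuousLinearMap.fst ℂ ℂ ℂ + Complex.I • ContinuousLinearMap.snd ℂ ℂ ℂ).prod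
      (ContinuousLinearMap.fst ℂ ℂ ℂ - Complex.I • ContinuousLinearMap.snd ℂ ℂ ℂ)
  let B : ℂ × ℂ →L[ℂ] ℂ × ℂ :=
    ((1/2 : ℂ) • (ContinuousLinearMap.fst ℂ ℂ ℂ + ContinuousLinearMap.snd ℂ ℂ ℂ)).prod
      ((-Complex.I/2 : ℂ) • (ContinuousLinearMap.fst ℂ ℂ ℂ - ContinuousLinearMap.snd ℂ ℂ ℂ))
  have hAB : ∀ x, A (B x) = x := by
    rintro ⟨x, y⟩
    have : Complex.I * Complex.I = -1 := Complex.I_mul_I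
    ext
    · simp [A, B]; linear_combination (-(x - y)/2) * this
    · simp [A, B]; linear_combination ((x - y)/2) * this
  have hAr : ∀ a b : ℝ, A ((a : ℂ), (b : ℂ)) = dlt (a + b * Complex.I) := by
    intro a b
    ext
    · simp [A, dlt_apply]; ring
    · simp [A, dlt_apply]; ring
  have hs0 : A ((s0.re : ℂ), (s0.im : ℂ)) = dlt s0 := by rw [hAr, Complex.re_add_im]
  have hBs0 : B (dlt s0) = ((s0.re : ℂ), (s0.im : ℂ)) := by
    ext
    · simp [B, dlt_apply, Complex.ext_iff]; ring
    · simp [B, dlt_apply, Complex.ext_iff]; ring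
  have hKA : AnalyticAt ℂ (K ∘ A) ((s0.re : ℂ), (s0.im : ℂ)) :=
    AnalyticAt.comp (by rw [hs0]; exact hK) (A.analyticAt _)
  obtain ⟨r, hr, han⟩ := an_ball hKA
  obtain ⟨ρ, hρ, hz⟩ := Metric.eventually_nhds_iff_ball.1 h
  let d := min r (ρ / 2)
  have hd : 0 < d := lt_min hr (by linarith)
  have hd1 : d ≤ r := min_le_left _ _
  have hd2 : d ≤ ρ / 2 := min_le_right _ _
  have hreal : ∀ a b : ℝ, (a : ℂ) ∈ Metric.ball (s0.re : ℂ) d → (b : ℂ) ∈ Metric.ball (s0.im : ℂ) d → K (A (a, b)) = 0 := by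
    intro a b ha hb
    rw [hAr]
    apply hz
    rw [Metric.mem_ball, dist_eq_norm] at ha hb ⊢
    have : (a + b * Complex.I - s0 : ℂ) = (a - s0.re) + (b - s0.im) * Complex.I := by
      conv_lhs => rw [← Complex.re_add_im s0]
      ring
    rw [this]
    refine (norm_add_le _ _).trans_lt ?_
    rw [norm_mul, Complex.norm_I, mul_one]
    linarith
  have hmem : ∀ z w : ℂ, z ∈ Metric.ball (s0.re : ℂ) d → w ∈ Metric.ball (s0.im : ℂ) d → AnalyticAt ℂ (K ∘ A) (z, w) := by
    intro z w hz hw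
    apply han
    rw [← ball_prod_same]
    exact ⟨Metric.ball_subset_ball hd1 hz, Metric.ball_subset_ball hd1 hw⟩
  have step1 : ∀ a : ℝ, (a : ℂ) ∈ Metric.ball (s0.re : ℂ) d → ∀ w ∈ Metric.ball (s0.im : ℂ) d, (K ∘ A) (a, w) = 0 := by
    intro a ha
    refine real_line_zero hd (g := fun w => (K ∘ A) ((a : ℂ), w)) ?_ ?_
    · intro w hw
      exact AnalyticAt.comp (g := K ∘ A) (f := fun w => ((a : ℂ), w)) (x := w) (hmem _ w ha hw) (analyticAt_const.prod analyticAt_id)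
    · intro b hb; exact hreal a b ha hb
  have step2 : ∀ w ∈ Metric.ball (s0.im : ℂ) d, ∀ z ∈ Metric.ball (s0.re : ℂ) d, (K ∘ A) (z, w) = 0 := by
    intro w hw
    refine real_line_zero hd (g := fun z => (K ∘ A) (z, w)) ?_ ?_
    · intro z hz
      exact AnalyticAt.comp (g := K ∘ A) (f := fun z => (z, w)) (x := z) (hmem z w hz hw) (analyticAt_id.prod analyticAt_const)
    · intro b hb; exact step1 b hb w hw
  have hev : ∀ᶠ x in 𝓝 (dlt s0), B x ∈ Metric.ball ((s0.re : ℂ), (s0.im : ℂ)) d := by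
    apply B.continuous.continuousAt.eventually
    rw [hBs0]
    exact Metric.ball_mem_nhds _ hd
  filter_upwards [hev] with x hx
  rw [← ball_prod_same] at hx
  have := step2 (B x).2 hx.2 (B x).1 hx.1
  simpa [hAB] using this

lemma diag_core {H : ℂ × ℂ → ℂ} {s0 : ℂ} (hH : AnalyticAt ℂ H (dlt s0))
    (hz : ∀ᶠ s in 𝓝 s0, fderiv ℂ (fun x => fderiv ℂ H x (0, 1)) (dlt s) (1, 0) = 0) :
    ∃ h : ℂ → ℂ, AnalyticAt ℂ h ((starRingEnd ℂ) s0) ∧ ∀ᶠ x in 𝓝 (dlt s0), fderiv ℂ H x (0, 1) = h x.2 := by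
  have hK := an_fderiv hH (0, 1)
  have h0 := diag_zero (an_fderiv hK (1, 0)) hz
  refine ⟨fun t => fderiv ℂ H (s0, t) (0, 1), ?_, ?_⟩
  · exact AnalyticAt.comp (g := fun x => fderiv ℂ H x (0, 1)) (x := (starRingEnd ℂ) s0) hK (analyticAt_const.prod analyticAt_id)
  · obtain ⟨r, hr, hb⟩ := Metric.eventually_nhds_iff_ball.1 (h0.and hK.eventually_analyticAt)
    filter_upwards [Metric.ball_mem_nhds _ hr] with x hx
    have hx' := hx
    rw [dlt_apply, ← ball_prod_same] at hx'
    have hd : ∀ s ∈ Metric.ball s0 r, HasDerivAt (fun s => fderiv ℂ H (s, x.2) (0, 1)) 0 s := by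
      intro s hs
      have hm : (s, x.2) ∈ Metric.ball (dlt s0) r := by
        rw [dlt_apply, ← ball_prod_same]; exact ⟨hs, hx'.2⟩
      have h1 := (hb _ hm).2.differentiableAt.hasFDerivAt
      have h2 : HasDerivAt (fun s : ℂ => (s, x.2)) (1, 0) s := (hasDerivAt_id s).prodMk (hasDerivAt_const s _)
      have h3 := HasFDerivAt.comp_hasDerivAt s h1 h2
      rw [(hb _ hm).1] at h3
      exact h3
    have := (Metric.isOpen_ball (x := s0) (ε := r)).is_const_of_deriv_eq_zero (convex_ball s0 r).isPreconnected
      (fun s hs => (hd s hs).differentiableAt.differentiableWithinAt) (fun s hs => (hd s hs).deriv) hx'.1 (Metric.mem_ball_self hr)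
    exact this
end

end

section
open Filter Topology

lemma lap_to_mixed {V : Set ℂ} (hV : IsOpen V) (v1 v2 : ℂ → ℝ) (h1 h2 : ℂ × ℂ → ℂ) (μ : ℝ)
    (a1 : ∀ s ∈ V, AnalyticAt ℂ h1 (dlt s)) (a2 : ∀ s ∈ V, AnalyticAt ℂ h2 (dlt s))
    (d1 : ∀ s ∈ V, h1 (dlt s) = (v1 s : ℂ)) (d2 : ∀ s ∈ V, h2 (dlt s) = (v2 s : ℂ))
    (heq : ∀ s ∈ V, lap v1 s = μ * lap v2 s) :
    ∀ s ∈ V, fderiv ℂ (fun x => fderiv ℂ (fun x => h1 x - μ * h2 x) x (0, 1)) (dlt s) (1, 0) = 0 := by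
  intro s hs
  have hVn := hV.mem_nhds hs
  have e1 : lap v1 s = 4 * (fderiv ℂ (fun x => fderiv ℂ h1 x (0, 1)) (dlt s) (1, 0)).re := by
    rw [← lap_diag (a1 s hs)]
    apply lap_congr
    filter_upwards [hVn] with t ht
    rw [d1 t ht, Complex.ofReal_re]
  have e2 : lap v2 s = 4 * (fderiv ℂ (fun x => fderiv ℂ h2 x (0, 1)) (dlt s) (1, 0)).re := by
    rw [← lap_diag (a2 s hs)]
    apply lap_congr
    filter_upwards [hVn] with t ht
    rw [d2 t ht, Complex.ofReal_re]
  have i1 := mixed_im (a1 s hs) (by filter_upwards [hVn] with t ht; rw [d1 t ht, Complex.ofReal_im])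
  have i2 := mixed_im (a2 s hs) (by filter_upwards [hVn] with t ht; rw [d2 t ht, Complex.ofReal_im])
  have h3 : (fun x => fderiv ℂ (fun x => h1 x - μ * h2 x) x (0, 1)) =ᶠ[𝓝 (dlt s)] fun x => fderiv ℂ h1 x (0, 1) - μ * fderiv ℂ h2 x (0, 1) := by
    filter_upwards [(a1 s hs).eventually_analyticAt, (a2 s hs).eventually_analyticAt] with x hx hy
    rw [fderiv_fun_sub hx.differentiableAt (hy.differentiableAt.const_mul _), fderiv_const_mul hy.differentiableAt]; rfl
  rw [h3.fderiv_eq, fderiv_fun_sub (an_fderiv (a1 s hs) _).differentiableAt ((an_fderiv (a2 s hs) _).differentiableAt.const_mul _), fderiv_const_mul (an_fderiv (a2 s hs) _).differentiableAt]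
  have h4 := heq s hs
  rw [e1, e2] at h4
  show _ - (μ : ℂ) * _ = 0
  apply Complex.ext
  · simp; linarith
  · simp [i1, i2]

lemma conj_an {g : ℂ → ℂ} {s : ℂ} (hg : AnalyticAt ℂ g s) :
    AnalyticAt ℂ (fun t => (starRingEnd ℂ) (g ((starRingEnd ℂ) t))) ((starRingEnd ℂ) s) := by
  obtain ⟨r, hr, h⟩ := an_ball hg
  have hd : DifferentiableOn ℂ (fun t => (starRingEnd ℂ) (g ((starRingEnd ℂ) t))) ((starRingEnd ℂ) ⁻¹' Metric.ball s r) := by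
    intro t ht
    have := (h _ ht).differentiableAt.star_star
    simp only [RCLike.star_def, Complex.conj_conj] at this
    exact DifferentiableAt.differentiableWithinAt this
  refine hd.analyticAt ((Metric.isOpen_ball.preimage Complex.continuous_conj).mem_nhds ?_)
  simpa using hr

lemma an_comp_pair {m : ℕ} {G1 G1' : ℂ → Fin m → ℂ} {Ψ : Em m → ℂ} {s t : ℂ} (h1 : AnalyticAt ℂ G1 s) (h2 : AnalyticAt ℂ G1' t)
    (h : AnalyticAt ℂ Ψ (G1 s, G1' t)) : AnalyticAt ℂ (fun x : ℂ × ℂ => Ψ (G1 x.1, G1' x.2)) (s, t) :=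
  AnalyticAt.comp (x := (s, t)) (f := fun x : ℂ × ℂ => (G1 x.1, G1' x.2)) h
    (AnalyticAt.prod (AnalyticAt.comp' (f := fun x : ℂ × ℂ => x.1) (x := (s, t)) h1 analyticAt_fst)
        (AnalyticAt.comp' (f := fun x : ℂ × ℂ => x.2) (x := (s, t)) h2 analyticAt_snd))
end


/-- Theorem 1 of the paper, in local coordinates.  `Φ` is the Nash-algebraic
polarization of `exp` of a Kähler potential of the exponent Nash-algebraic base,
the fiber metric is `h = (Re Φ)^l`, `𝔹` is the unit ball bundle of the `k`-fold
direct sum, and `exp ∘ u` is rational.  Any holomorphic `F : V → ℂ^n` whose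
pullback of the Euclidean Kähler form is `μ` times the pullback under a
holomorphic `G = (G₁, G₂) : V → 𝔹` of the ansatz form
`α π*(Ric) + β π*(ω) + i∂∂̄ u(‖v‖²)` (expressed as a Laplacian identity in the
one-dimensional parameter) must be constant. -/
theorem constant_of_shared_ball_bundle (m : ℕ) (hm : 0 < m)
    (U : Set (Fin m → ℂ)) (hUo : IsOpen U) (hUc : IsConnected U)
    (Φ : (Fin m → ℂ) × (Fin m → ℂ) → ℂ)
    (hΦNash : IsNashOnPair m (U ×ˢ {w : Fin m → ℂ | star w ∈ U}) Φ)
    (hΦne : ∀ p ∈ U ×ˢ {w : Fin m → ℂ | star w ∈ U}, Φ p ≠ 0)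
    (hΦreal : ∀ z ∈ U, (Φ (z, star z)).im = 0)
    (hΦpos : ∀ z ∈ U, 0 < (Φ (z, star z)).re)
    (hgpos : ∀ z ∈ U,
      Matrix.PosDef (Matrix.of fun i j : Fin m => gMat m Φ i j (z, star z)))
    (l : ℝ) (k n : ℕ) (hk : 0 < k) (hn : 0 < n) (α β μ : ℝ)
    (u : ℝ → ℝ) (hu : ContDiffOn ℝ (⊤ : ℕ∞) u (Set.Ico (0 : ℝ) 1))
    (p q : Polynomial ℝ)
    (hq : ∀ x ∈ Set.Ico (0 : ℝ) 1, Polynomial.eval x q ≠ 0)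
    (hrat : ∀ x ∈ Set.Ico (0 : ℝ) 1,
      Real.exp (u x) = Polynomial.eval x p / Polynomial.eval x q)
    (V : Set ℂ) (hVo : IsOpen V) (hVc : IsConnected V)
    (f : Fin n → ℂ → ℂ) (hf : ∀ j, DifferentiableOn ℂ (f j) V)
    (G₁ : ℂ → Fin m → ℂ) (G₂ : ℂ → Fin k → ℂ)
    (hG₁ : DifferentiableOn ℂ G₁ V) (hG₂ : DifferentiableOn ℂ G₂ V)
    (hGU : ∀ s ∈ V, G₁ s ∈ U)
    (hGball : ∀ s ∈ V,
      (∑ j, Complex.normSq (G₂ s j)) * ((Φ (G₁ s, star (G₁ s))).re ^ l) < 1)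
    (heq : ∀ s ∈ V,
      lap (fun t => ∑ j, Complex.normSq (f j t)) s =
        μ * lap (fun t =>
          -α * Real.log ((detG m Φ (G₁ t, star (G₁ t))).re) +
            β * Real.log ((Φ (G₁ t, star (G₁ t))).re) +
            u ((∑ j, Complex.normSq (G₂ t j)) *
              ((Φ (G₁ t, star (G₁ t))).re ^ l))) s) :
    ∀ s ∈ V, ∀ t ∈ V, ∀ j, f j s = f j t := by
  classical
  set W : Set (Em m) := U ×ˢ {w : Fin m → ℂ | star w ∈ U} with hW
  have hWo : IsOpen W := hUo.prod (hUo.preimage continuous_star)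
  have hWd : ∀ z ∈ U, (z, star z) ∈ W := fun z hz => ⟨hz, by simpa using hz⟩
  have hNΦ : ∀ z ∈ U, NashG (z, star z) Φ := fun z hz => IsNashOnPair.nashG hWo hΦNash (hWd z hz)
  have hND : ∀ z ∈ U, NashG (z, star z) (detG m Φ) := fun z hz => (hNΦ z hz).detG (hΦne _ (hWd z hz))
  have hΦr : ∀ z ∈ U, Φ (z, star z) = ((Φ (z, star z)).re : ℂ) := fun z hz =>
    Complex.ext (by simp) (by simpa using hΦreal z hz)
  have hDpos : ∀ z ∈ U, 0 < detG m Φ (z, star z) := fun z hz => (hgpos z hz).det_pos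
  have hDpos' : ∀ z ∈ U, 0 < (detG m Φ (z, star z)).re := fun z hz => (Complex.lt_def.1 (hDpos z hz)).1
  have hDr : ∀ z ∈ U, detG m Φ (z, star z) = ((detG m Φ (z, star z)).re : ℂ) := fun z hz =>
    Complex.ext (by simp) (by simpa using (Complex.lt_def.1 (hDpos z hz)).2.symm)
  -- conjugate maps
  let f' : Fin n → ℂ → ℂ := fun j t => (starRingEnd ℂ) (f j ((starRingEnd ℂ) t))
  let e : Fin k → ℂ → ℂ := fun j t => G₂ t j
  let e' : Fin k → ℂ → ℂ := fun j t => (starRingEnd ℂ) (e j ((starRingEnd ℂ) t))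
  let G1' : ℂ → Fin m → ℂ := fun t => star (G₁ ((starRingEnd ℂ) t))
  have hfa : ∀ s ∈ V, ∀ j, AnalyticAt ℂ (f j) s := fun s hs j => (hf j).analyticAt (hVo.mem_nhds hs)
  have hfa' : ∀ s ∈ V, ∀ j, AnalyticAt ℂ (f' j) ((starRingEnd ℂ) s) := fun s hs j => conj_an (hfa s hs j)
  have hea : ∀ s ∈ V, ∀ j, AnalyticAt ℂ (e j) s := fun s hs j =>
    (differentiableOn_pi.1 hG₂ j).analyticAt (hVo.mem_nhds hs)
  have hea' : ∀ s ∈ V, ∀ j, AnalyticAt ℂ (e' j) ((starRingEnd ℂ) s) := fun s hs j => conj_an (hea s hs j)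
  have hGa : ∀ s ∈ V, AnalyticAt ℂ G₁ s := fun s hs => hG₁.analyticAt (hVo.mem_nhds hs)
  have hGa' : ∀ s ∈ V, AnalyticAt ℂ G1' ((starRingEnd ℂ) s) := fun s hs => by
    rw [analyticAt_pi_iff]
    intro i
    exact conj_an ((differentiableOn_pi.1 hG₁ i).analyticAt (hVo.mem_nhds hs))
  have hG1s : ∀ s, G1' ((starRingEnd ℂ) s) = star (G₁ s) := fun s => by simp [G1']
  -- functions on the complexification
  let L1 : ℂ × ℂ → ℂ := fun x => Complex.log (detG m Φ (G₁ x.1, G1' x.2))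
  let L2 : ℂ × ℂ → ℂ := fun x => Complex.log (Φ (G₁ x.1, G1' x.2))
  let X : ℂ × ℂ → ℂ := fun x => (∑ j, e j x.1 * e' j x.2) * Complex.exp ((l : ℂ) * L2 x)
  let P : Polynomial ℂ := p.map Complex.ofRealHom
  let Q : Polynomial ℂ := q.map Complex.ofRealHom
  let L3 : ℂ × ℂ → ℂ := fun x => Complex.log (P.eval (X x) / Q.eval (X x))
  have aΦ : ∀ s ∈ V, AnalyticAt ℂ (fun x : ℂ × ℂ => Φ (G₁ x.1, G1' x.2)) (dlt s) := fun s hs =>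
    an_comp_pair (hGa s hs) (hGa' s hs) (by
      show AnalyticAt ℂ Φ (G₁ s, G1' ((starRingEnd ℂ) s))
      rw [hG1s]; exact (hNΦ _ (hGU s hs)).1)
  have aD : ∀ s ∈ V, AnalyticAt ℂ (fun x : ℂ × ℂ => detG m Φ (G₁ x.1, G1' x.2)) (dlt s) := fun s hs =>
    an_comp_pair (hGa s hs) (hGa' s hs) (by
      show AnalyticAt ℂ (detG m Φ) (G₁ s, G1' ((starRingEnd ℂ) s))
      rw [hG1s]; exact (hND _ (hGU s hs)).1)
  have dΦ : ∀ s ∈ V, Φ (G₁ (dlt s).1, G1' (dlt s).2) = ((Φ (G₁ s, star (G₁ s))).re : ℂ) := fun s hs => by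
    rw [dlt_apply, hG1s]; exact hΦr _ (hGU s hs)
  have dD : ∀ s ∈ V, detG m Φ (G₁ (dlt s).1, G1' (dlt s).2) = ((detG m Φ (G₁ s, star (G₁ s))).re : ℂ) := fun s hs => by
    rw [dlt_apply, hG1s]; exact hDr _ (hGU s hs)
  have aL1 : ∀ s ∈ V, AnalyticAt ℂ L1 (dlt s) := fun s hs =>
    (aD s hs).clog (by rw [dD s hs]; exact Complex.ofReal_mem_slitPlane.2 (hDpos' _ (hGU s hs)))
  have aL2 : ∀ s ∈ V, AnalyticAt ℂ L2 (dlt s) := fun s hs =>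
    (aΦ s hs).clog (by rw [dΦ s hs]; exact Complex.ofReal_mem_slitPlane.2 (hΦpos _ (hGU s hs)))
  have dL1 : ∀ s ∈ V, L1 (dlt s) = (Real.log ((detG m Φ (G₁ s, star (G₁ s))).re) : ℂ) := fun s hs => by
    simp only [L1]
    rw [dD s hs, Complex.ofReal_log (hDpos' _ (hGU s hs)).le]
  have dL2 : ∀ s ∈ V, L2 (dlt s) = (Real.log ((Φ (G₁ s, star (G₁ s))).re) : ℂ) := fun s hs => by
    simp only [L2]
    rw [dΦ s hs, Complex.ofReal_log (hΦpos _ (hGU s hs)).le]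
  let xr : ℂ → ℝ := fun t => (∑ j, Complex.normSq (G₂ t j)) * ((Φ (G₁ t, star (G₁ t))).re ^ l)
  have dX : ∀ s ∈ V, X (dlt s) = (xr s : ℂ) := fun s hs => by
    simp only [X, xr]
    rw [dL2 s hs, Real.rpow_def_of_pos (hΦpos _ (hGU s hs))]
    push_cast
    congr 1
    · refine Finset.sum_congr rfl fun j _ => ?_
      simp [e', e, dlt_apply, Complex.mul_conj]
    · rw [mul_comm]
  have aX : ∀ s ∈ V, AnalyticAt ℂ X (dlt s) := fun s hs => by
    refine AnalyticAt.mul ?_ (analyticAt_const.mul (aL2 s hs)).cexp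
    exact Finset.analyticAt_fun_sum _ fun j _ => (an_fst (hea s hs j)).mul (an_snd (hea' s hs j))
  have hxr : ∀ s ∈ V, xr s ∈ Set.Ico (0 : ℝ) 1 := fun s hs =>
    ⟨mul_nonneg (Finset.sum_nonneg fun j _ => Complex.normSq_nonneg _) (Real.rpow_nonneg (hΦpos _ (hGU s hs)).le _), hGball s hs⟩
  have dP : ∀ s ∈ V, P.eval (X (dlt s)) = ((p.eval (xr s) : ℝ) : ℂ) := fun s hs => by
    rw [dX s hs]; exact Polynomial.eval_map_apply (f := Complex.ofRealHom) (xr s)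
  have dQ : ∀ s ∈ V, Q.eval (X (dlt s)) = ((q.eval (xr s) : ℝ) : ℂ) := fun s hs => by
    rw [dX s hs]; exact Polynomial.eval_map_apply (f := Complex.ofRealHom) (xr s)
  have dQ0 : ∀ s ∈ V, Q.eval (X (dlt s)) ≠ 0 := fun s hs => by
    rw [dQ s hs]; exact_mod_cast hq _ (hxr s hs)
  have dPQ : ∀ s ∈ V, P.eval (X (dlt s)) / Q.eval (X (dlt s)) = ((Real.exp (u (xr s)) : ℝ) : ℂ) := fun s hs => by
    rw [dP s hs, dQ s hs, hrat _ (hxr s hs)]; push_cast; rfl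
  have aPQ : ∀ s ∈ V, AnalyticAt ℂ (fun x => P.eval (X x) / Q.eval (X x)) (dlt s) := fun s hs =>
    (an_eval (aX s hs) P).div (an_eval (aX s hs) Q) (dQ0 s hs)
  have aL3 : ∀ s ∈ V, AnalyticAt ℂ L3 (dlt s) := fun s hs =>
    (aPQ s hs).clog (by rw [dPQ s hs]; exact Complex.ofReal_mem_slitPlane.2 (Real.exp_pos _))
  have dL3 : ∀ s ∈ V, L3 (dlt s) = (u (xr s) : ℂ) := fun s hs => by
    simp only [L3]
    rw [dPQ s hs, ← Complex.ofReal_log (Real.exp_pos _).le, Real.log_exp]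
  have hmix := lap_to_mixed hVo _ _ (fun x => ∑ j, f j x.1 * f' j x.2)
    (fun x => -(α : ℂ) * L1 x + β * L2 x + L3 x) μ
    (fun s hs => Finset.analyticAt_fun_sum _ fun j _ => (an_fst (hfa s hs j)).mul (an_snd (hfa' s hs j)))
    (fun s hs => ((analyticAt_const.mul (aL1 s hs)).add (analyticAt_const.mul (aL2 s hs))).add (aL3 s hs))
    (fun s hs => by
      push_cast
      refine Finset.sum_congr rfl fun j _ => ?_
      simp [f', dlt_apply, Complex.mul_conj])
    (fun s hs => by
      simp only [dL1 s hs, dL2 s hs, dL3 s hs, xr]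
      push_cast
      rfl) heq
  have hloc : ∀ s0 ∈ V, ∀ j, ∀ᶠ s in nhds s0, f j s = f j s0 := by
    intro s0 hs0
    let H : ℂ × ℂ → ℂ := fun x => ∑ j, f j x.1 * f' j x.2 - (((-μ * α : ℝ) : ℂ) * L1 x + ((μ * β : ℝ) : ℂ) * L2 x + (μ : ℂ) * L3 x)
    have hHe : (fun x => (∑ j, f j x.1 * f' j x.2) - (μ : ℂ) * (-(α : ℂ) * L1 x + β * L2 x + L3 x)) = H := by
      funext x
      simp only [H]
      push_cast
      ring
    have hmix' : ∀ s ∈ V, fderiv ℂ (fun x => fderiv ℂ H x (0, 1)) (dlt s) (1, 0) = 0 := by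
      rw [← hHe]; exact hmix
    have aH : AnalyticAt ℂ H (dlt s0) :=
      (Finset.analyticAt_fun_sum _ fun j _ => (an_fst (hfa s0 hs0 j)).mul (an_snd (hfa' s0 hs0 j))).sub
        (((analyticAt_const.mul (aL1 s0 hs0)).add (analyticAt_const.mul (aL2 s0 hs0))).add (analyticAt_const.mul (aL3 s0 hs0)))
    obtain ⟨h, hh, hH⟩ := diag_core aH (by filter_upwards [hVo.mem_nhds hs0] with s hs using hmix' s hs)
    have hz := core_fun s0 ((starRingEnd ℂ) s0) f f' (hfa s0 hs0) (hfa' s0 hs0) e e' (hea s0 hs0) (hea' s0 hs0)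
      G₁ G1' (hGa s0 hs0) (hGa' s0 hs0) Φ (detG m Φ) (by rw [hG1s]; exact hNΦ _ (hGU s0 hs0)) (by rw [hG1s]; exact hND _ (hGU s0 hs0))
      L1 L2 L3 (aL1 s0 hs0) (aL2 s0 hs0) (aL3 s0 hs0) P Q _ _ _ (l : ℂ)
      (by
        have h0 : detG m Φ (G₁ (dlt s0).1, G1' (dlt s0).2) ≠ 0 := by
          rw [dD s0 hs0]; exact_mod_cast (hDpos' _ (hGU s0 hs0)).ne'
        filter_upwards [(aD s0 hs0).continuousAt.eventually_ne h0] with x hx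
        exact Complex.exp_log hx)
      (by
        have h0 : Φ (G₁ (dlt s0).1, G1' (dlt s0).2) ≠ 0 := by
          rw [dΦ s0 hs0]; exact_mod_cast (hΦpos _ (hGU s0 hs0)).ne'
        filter_upwards [(aΦ s0 hs0).continuousAt.eventually_ne h0] with x hx
        exact Complex.exp_log hx)
      X rfl (dQ0 s0 hs0)
      (by
        have h0 : P.eval (X (dlt s0)) / Q.eval (X (dlt s0)) ≠ 0 := by
          rw [dPQ s0 hs0]; exact_mod_cast (Real.exp_pos _).ne'
        filter_upwards [(aPQ s0 hs0).continuousAt.eventually_ne h0,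
          (an_eval (aX s0 hs0) Q).continuousAt.eventually_ne (dQ0 s0 hs0)] with x hx hx2
        simp only [L3]
        rw [Complex.exp_log hx, div_mul_cancel₀ _ hx2])
      H rfl h hh hH
    have hz2 : ∀ᶠ s in nhds s0, ∑ j, (f j (dlt s).1 - f j s0) * (f' j (dlt s).2 - f' j ((starRingEnd ℂ) s0)) = 0 :=
      dlt.continuous.continuousAt.eventually hz
    intro j
    filter_upwards [hz2] with s hs
    have h1 : ∑ j, Complex.normSq (f j s - f j s0) = 0 := by
      have : ((∑ j, Complex.normSq (f j s - f j s0) : ℝ) : ℂ) = 0 := by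
        rw [← hs]
        push_cast
        refine Finset.sum_congr rfl fun j _ => ?_
        rw [Complex.normSq_eq_conj_mul_self, mul_comm]
        simp [f', dlt_apply]
      exact_mod_cast this
    have h2 := (Finset.sum_eq_zero_iff_of_nonneg fun j _ => Complex.normSq_nonneg _).1 h1 j (Finset.mem_univ j)
    exact sub_eq_zero.1 (Complex.normSq_eq_zero.1 h2)
  intro s hs t ht j
  have hEq : Set.EqOn (f j) (fun _ => f j t) V :=
    AnalyticOnNhd.eqOn_of_preconnected_of_eventuallyEq (fun x hx => hfa x hx j) (fun x _ => analyticAt_const)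
      hVc.isPreconnected ht (hloc t ht j)
  exact hEq hs
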